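/- Among the real numbers in the infinite collection consisting of the Euler–Mascheroni constant γ together with all values ψ(r/n), where n ranges over all integers n > 1 and r over all integers with 1 ≤ r < n and gcd(r, n) = 1, at most one is algebraic: there do not exist two distinct members of this collection (i.e., γ and some ψ(r/n), or ψ(r₁/n₁) and ψ(r₂/n₂) with r₁/n₁ ≠ r₂/n₂) that are both algebraic over ℚ. -/

import Mathlib

/-- The digamma function `ψ(x) = -γ - 1/x + ∑_{n=1}^∞ (1/n - 1/(n+x))` for real `x`. -/
noncomputable def digamma (x : ℝ) : ℝ :=
  -Real.eulerMascheroniConstant - 1 / x +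
    ∑' k : ℕ, (1 / ((k : ℝ) + 1) - 1 / (((k : ℝ) + 1) + x))

/-- The infinite collection consisting of `γ` together with all values `ψ(r/n)` for
`n > 1`, `1 ≤ r < n`, `gcd(r, n) = 1`. -/
def digammaSetAll : Set ℝ :=
  {Real.eulerMascheroniConstant} ∪
    {x : ℝ | ∃ n r : ℕ, 1 < n ∧ 1 ≤ r ∧ r < n ∧ Nat.gcd r n = 1 ∧
      x = digamma ((r : ℝ) / (n : ℝ))}

open Finset Polynomial NumberField Filter Topology

/-- An entire function vanishing at `c` is divisible by `z - c`. -/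
lemma Differentiable.exists_eq_sub_mul {f : ℂ → ℂ} (hf : Differentiable ℂ f) {c : ℂ}
    (hc : f c = 0) : ∃ g : ℂ → ℂ, Differentiable ℂ g ∧ ∀ z, f z = (z - c) * g z := by
  refine ⟨dslope f c, ?_, fun z ↦ ?_⟩
  · rw [← differentiableOn_univ, Complex.differentiableOn_dslope Filter.univ_mem]
    exact hf.differentiableOn
  · have := sub_smul_dslope f c z
    rw [hc, sub_zero, smul_eq_mul] at this
    exact this.symm

/-- An entire function vanishing to order at least `k` at `c` is divisible by `(z - c) ^ k`. -/
lemma Differentiable.exists_eq_sub_pow_mul {f : ℂ → ℂ} (hf : Differentiable ℂ f) {c : ℂ} {k : ℕ}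
    (hc : (k : ℕ∞) ≤ analyticOrderAt f c) :
    ∃ g : ℂ → ℂ, Differentiable ℂ g ∧ ∀ z, f z = (z - c) ^ k * g z := by
  induction k generalizing f with
  | zero => exact ⟨f, hf, fun z ↦ by simp⟩
  | succ k ih =>
    have h0 : f c = 0 := by
      apply apply_eq_zero_of_analyticOrderAt_ne_zero
      intro h
      rw [h] at hc
      simp at hc
    obtain ⟨g, hg, hfg⟩ := hf.exists_eq_sub_mul h0
    have hord : (k : ℕ∞) ≤ analyticOrderAt g c := by
      have hfe : f = (fun z ↦ z - c) * g := funext hfg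
      rw [hfe, analyticOrderAt_mul (by fun_prop) (hg.analyticAt c)] at hc
      have : analyticOrderAt (fun z : ℂ ↦ z - c) c = 1 := analyticOrderAt_id_sub_const_self
      rw [this, Nat.cast_succ, add_comm] at hc
      exact (ENat.add_le_add_iff_left (by simp)).1 hc
    obtain ⟨q, hq, hgq⟩ := ih hg hord
    exact ⟨q, hq, fun z ↦ by rw [hfg, hgq]; ring⟩

/-- An entire function vanishing to order at least `k` on a finite set factors accordingly. -/
lemma Differentiable.exists_eq_prod_pow_mul {f : ℂ → ℂ} (hf : Differentiable ℂ f) {k : ℕ}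
    (s : Finset ℂ) (hs : ∀ c ∈ s, (k : ℕ∞) ≤ analyticOrderAt f c) :
    ∃ g : ℂ → ℂ, Differentiable ℂ g ∧ ∀ z, f z = (∏ c ∈ s, (z - c) ^ k) * g z := by
  classical
  induction s using Finset.induction_on generalizing f with
  | empty => exact ⟨f, hf, fun z ↦ by simp⟩
  | insert a s ha ih =>
    obtain ⟨g, hg, hfg⟩ := hf.exists_eq_sub_pow_mul (hs a (mem_insert_self _ _))
    have hord : ∀ c ∈ s, (k : ℕ∞) ≤ analyticOrderAt g c := by
      intro c hc
      have hca : c ≠ a := fun h ↦ ha (h ▸ hc)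
      have hfe : f = (fun z ↦ (z - a) ^ k) * g := funext hfg
      have h1 := hs c (mem_insert_of_mem hc)
      have h2 : AnalyticAt ℂ (fun z : ℂ ↦ (z - a) ^ k) c := by fun_prop
      have h3 : analyticOrderAt (fun z : ℂ ↦ (z - a) ^ k) c = 0 := by
        rw [h2.analyticOrderAt_eq_zero]
        exact pow_ne_zero _ (sub_ne_zero.2 hca)
      rwa [hfe, analyticOrderAt_mul h2 (hg.analyticAt c), h3, zero_add] at h1
    obtain ⟨q, hq, hgq⟩ := ih hg hord
    exact ⟨q, hq, fun z ↦ by rw [hfg, hgq, prod_insert ha]; ring⟩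

/-- A Schwarz lemma for entire functions with many zeros in a disc. -/
lemma norm_le_div_two_pow_of_analyticOrderAt {f : ℂ → ℂ} (hf : Differentiable ℂ f) {k : ℕ}
    {s : Finset ℂ} (hs : ∀ c ∈ s, (k : ℕ∞) ≤ analyticOrderAt f c) {r B : ℝ} (hr : 0 < r)
    (hsr : ∀ c ∈ s, ‖c‖ ≤ r) (hB : ∀ z, ‖z‖ = 5 * r → ‖f z‖ ≤ B) {w : ℂ} (hw : ‖w‖ ≤ r) :
    ‖f w‖ ≤ B / 2 ^ (k * #s) := by
  obtain ⟨g, hg, hfg⟩ := hf.exists_eq_prod_pow_mul s hs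
  have h4 : (0 : ℝ) < (4 * r) ^ (k * #s) := by positivity
  have hgB : ∀ z ∈ frontier (Metric.ball (0 : ℂ) (5 * r)), ‖g z‖ ≤ B / (4 * r) ^ (k * #s) := by
    intro z hz
    rw [frontier_ball _ (by positivity), mem_sphere_zero_iff_norm] at hz
    rw [le_div_iff₀ h4]
    calc ‖g z‖ * (4 * r) ^ (k * #s) ≤ ‖g z‖ * ‖∏ c ∈ s, (z - c) ^ k‖ := by
          gcongr
          rw [norm_prod, pow_mul, ← prod_const]
          refine prod_le_prod (fun _ _ ↦ by positivity) fun c hc ↦ ?_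
          rw [norm_pow]
          gcongr
          have := norm_sub_norm_le z c
          linarith [hsr c hc]
      _ = ‖f z‖ := by rw [hfg, norm_mul, mul_comm]
      _ ≤ B := hB z hz
  have hgw : ‖g w‖ ≤ B / (4 * r) ^ (k * #s) := by
    refine Complex.norm_le_of_forall_mem_frontier_norm_le Metric.isBounded_ball
      hg.diffContOnCl hgB (subset_closure ?_)
    rw [mem_ball_zero_iff]
    linarith
  calc ‖f w‖ = ‖∏ c ∈ s, (w - c) ^ k‖ * ‖g w‖ := by rw [hfg, norm_mul]
    _ ≤ (2 * r) ^ (k * #s) * (B / (4 * r) ^ (k * #s)) := by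
        gcongr
        rw [norm_prod, pow_mul, ← prod_const]
        refine prod_le_prod (fun _ _ ↦ by positivity) fun c hc ↦ ?_
        rw [norm_pow]
        gcongr
        have := norm_sub_le w c
        linarith [hsr c hc]
    _ = B / 2 ^ (k * #s) := by
        rw [show (4 * r) = 2 * (2 * r) by ring, mul_pow 2 (2 * r)]
        field_simp

/-- If `f' - ω f` is bounded by `Q N exp ((Ω + Q)|z|)`, then `f` is bounded by
`N exp ((Ω + Q)|z|)`. -/
lemma norm_le_of_norm_deriv_sub_mul_le {f : ℂ → ℂ} (hf : Differentiable ℂ f) {ω : ℂ}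
    {Ω Q N : ℝ} (hω : ‖ω‖ ≤ Ω) (h0 : ‖f 0‖ ≤ N)
    (h : ∀ z, ‖deriv f z - ω * f z‖ ≤ Q * N * Real.exp ((Ω + Q) * ‖z‖)) (z : ℂ) :
    ‖f z‖ ≤ N * Real.exp ((Ω + Q) * ‖z‖) := by
  have hexp : ∀ t : ℝ, t ≤ 1 →
      ‖Complex.exp (ω * z * (1 - t))‖ ≤ Real.exp (Ω * ‖z‖ * (1 - t)) := by
    intro t ht
    rw [Complex.norm_exp]
    gcongr
    refine (Complex.re_le_norm _).trans ?_
    have : ‖(1 - t : ℂ)‖ = 1 - t := by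
      rw [← Complex.ofReal_one, ← Complex.ofReal_sub, Complex.norm_real, Real.norm_of_nonneg]
      linarith
    rw [norm_mul, norm_mul, this]
    have : 0 ≤ 1 - t := by linarith
    gcongr
  have hd : ∀ t : ℝ, HasDerivAt (fun t : ℝ ↦ Complex.exp (ω * z * (1 - t)) * f (t * z))
      (z * Complex.exp (ω * z * (1 - t)) * (deriv f (t * z) - ω * f (t * z))) t := by
    intro t
    have h1 : HasDerivAt (fun t : ℝ ↦ (t : ℂ)) 1 t := Complex.ofRealCLM.hasDerivAt
    have h2 : HasDerivAt (fun t : ℝ ↦ f (t * z)) (deriv f (t * z) * (1 * z)) t :=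
      (hf (t * z)).hasDerivAt.comp t (h1.mul_const z)
    have h3 : HasDerivAt (fun t : ℝ ↦ ω * z * (1 - (t : ℂ))) (ω * z * (-1)) t :=
      (h1.const_sub 1).const_mul (ω * z)
    convert! h3.cexp.mul h2 using 1
    ring
  have key := image_norm_le_of_norm_deriv_right_le_deriv_boundary (a := 0) (b := 1)
    (f := fun t : ℝ ↦ Complex.exp (ω * z * (1 - t)) * f (t * z))
    (B := fun t : ℝ ↦ N * Real.exp (Ω * ‖z‖ + Q * ‖z‖ * t))
    (B' := fun t : ℝ ↦ N * (Real.exp (Ω * ‖z‖ + Q * ‖z‖ * t) * (Q * ‖z‖)))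
    (fun t _ ↦ (hd t).continuousAt.continuousWithinAt) (fun t _ ↦ (hd t).hasDerivWithinAt)
    ?_ ?_ ?_ (x := 1) (by simp)
  · have he : (Ω + Q) * ‖z‖ = Ω * ‖z‖ + Q * ‖z‖ := by ring
    simpa [he] using key
  · have := hexp 0 zero_le_one
    simp only [Complex.ofReal_zero, sub_zero, mul_one, zero_mul, mul_zero, add_zero, norm_mul]
      at this ⊢
    rw [mul_comm N]
    gcongr
  · intro t
    have h3 : HasDerivAt (fun t : ℝ ↦ Ω * ‖z‖ + Q * ‖z‖ * t) (Q * ‖z‖ * 1) t :=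
      ((hasDerivAt_id t).const_mul (Q * ‖z‖)).const_add _
    simpa using h3.exp.const_mul N
  · intro t ht
    have ht1 : ‖(t : ℂ)‖ = t := by rw [Complex.norm_real, Real.norm_of_nonneg ht.1]
    rw [norm_mul, norm_mul]
    calc ‖z‖ * ‖Complex.exp (ω * z * (1 - t))‖ * ‖deriv f (t * z) - ω * f (t * z)‖
        ≤ ‖z‖ * Real.exp (Ω * ‖z‖ * (1 - t)) * (Q * N * Real.exp ((Ω + Q) * ‖t * z‖)) := by
          gcongr
          · exact hexp t ht.2.le
          · exact h _
      _ = ‖z‖ * (Q * N) * (Real.exp (Ω * ‖z‖ * (1 - t)) * Real.exp ((Ω + Q) * (t * ‖z‖))) := by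
          rw [norm_mul, ht1]; ring
      _ = N * (Real.exp (Ω * ‖z‖ + Q * ‖z‖ * t) * (Q * ‖z‖)) := by
          rw [← Real.exp_add]; ring_nf

/-- Applying `d/dz - ω v` to an exponential polynomial lowers the degree of the coefficient
of `exp (ω v z)`. -/
lemma coeff_derivative_add_C_sub_mul_eq_zero {ι : Type*} [DecidableEq ι] {ω : ι → ℂ} {q : ι → ℂ[X]}
    {d : ι → ℕ} (hq : ∀ u m, d u ≤ m → (q u).coeff m = 0) {v : ι} (u : ι) (m : ℕ)
    (hm : Function.update d v (d v - 1) u ≤ m) :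
    (derivative (q u) + C (ω u - ω v) * q u).coeff m = 0 := by
  rw [coeff_add, coeff_derivative, coeff_C_mul]
  by_cases huv : u = v
  · subst huv
    rw [Function.update_self] at hm
    rw [hq u (m + 1) (by omega), sub_self]
    simp
  · rw [Function.update_of_ne huv] at hm
    rw [hq u m hm, hq u (m + 1) (by omega)]
    simp

section ExpPoly

variable {ι : Type*} [Fintype ι]

/-- The exponential polynomial `∑ u, q u (z) exp (ω u z)`. -/
noncomputable def expPoly (ω : ι → ℂ) (q : ι → ℂ[X]) (z : ℂ) : ℂ :=
  ∑ u, (q u).eval z * Complex.exp (ω u * z)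

lemma hasDerivAt_expPoly (ω : ι → ℂ) (q : ι → ℂ[X]) (z : ℂ) :
    HasDerivAt (expPoly ω q) (expPoly ω (fun u ↦ derivative (q u) + C (ω u) * q u) z) z := by
  unfold expPoly
  refine HasDerivAt.fun_sum fun u _ ↦ ?_
  have h : HasDerivAt (fun z ↦ ω u * z) (ω u * 1) z := (hasDerivAt_id z).const_mul (ω u)
  convert! ((q u).hasDerivAt z).mul h.cexp using 1
  simp
  ring

lemma differentiable_expPoly (ω : ι → ℂ) (q : ι → ℂ[X]) : Differentiable ℂ (expPoly ω q) :=
  fun z ↦ (hasDerivAt_expPoly ω q z).differentiableAt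

lemma deriv_expPoly_sub_mul (ω : ι → ℂ) (q : ι → ℂ[X]) (a z : ℂ) :
    deriv (expPoly ω q) z - a * expPoly ω q z =
      expPoly ω (fun u ↦ derivative (q u) + C (ω u - a) * q u) z := by
  rw [(hasDerivAt_expPoly ω q z).deriv]
  unfold expPoly
  rw [mul_sum, ← sum_sub_distrib]
  refine sum_congr rfl fun u _ ↦ ?_
  simp
  ring

lemma exists_pos_and_sum_update_of_sum_eq_succ [DecidableEq ι] {d : ι → ℕ} {D : ℕ}
    (hd : ∑ u, d u = D + 1) : ∃ v, 0 < d v ∧ ∑ u, Function.update d v (d v - 1) u = D := by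
  obtain ⟨v, -, hv⟩ : ∃ v ∈ univ, d v ≠ 0 := by
    by_contra! h
    rw [sum_eq_zero h] at hd
    omega
  refine ⟨v, Nat.pos_of_ne_zero hv, ?_⟩
  rw [sum_update_of_mem (mem_univ v)]
  rw [← add_sum_erase univ d (mem_univ v)] at hd
  rw [sdiff_singleton_eq_erase]
  omega

/-- The growth of an exponential polynomial is controlled by its size on a disc. -/
lemma norm_expPoly_le {ω : ι → ℂ} {Ω δ : ℝ} (hω : ∀ u, ‖ω u‖ ≤ Ω) (hδ : 0 < δ) {D : ℕ}
    {q : ι → ℂ[X]} {d : ι → ℕ} (hd : ∑ u, d u = D) (hq : ∀ u m, d u ≤ m → (q u).coeff m = 0)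
    {N : ℝ} (hN : ∀ z, ‖z‖ ≤ δ * D → ‖expPoly ω q z‖ ≤ N) (z : ℂ) :
    ‖expPoly ω q z‖ ≤ N * Real.exp ((Ω + (1 / δ + Ω)) * ‖z‖) := by
  classical
  induction D generalizing q d N z with
  | zero =>
    have hq0 : ∀ u, q u = 0 := fun u ↦ by
      ext m
      exact hq u m (by rw [(sum_eq_zero_iff.1 hd) u (mem_univ u)]; exact Nat.zero_le m)
    have h0 : ∀ z, expPoly ω q z = 0 := fun z ↦ by simp [expPoly, hq0]
    have := hN 0 (by simp)
    rw [h0, norm_zero] at this ⊢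
    positivity
  | succ D ih =>
    obtain ⟨v, -, hv⟩ := exists_pos_and_sum_update_of_sum_eq_succ hd
    have hD : δ * (D + 1 : ℕ) = δ * D + δ := by push_cast; ring
    have hDpos : 0 ≤ δ * D := by positivity
    refine norm_le_of_norm_deriv_sub_mul_le (differentiable_expPoly ω q) (hω v)
      (hN 0 (by simpa using by positivity)) (fun w ↦ ?_) z
    rw [deriv_expPoly_sub_mul]
    refine ih hv (coeff_derivative_add_C_sub_mul_eq_zero hq) (fun y hy ↦ ?_) w
    rw [← deriv_expPoly_sub_mul]
    have h1 : ‖deriv (expPoly ω q) y‖ ≤ N / δ := by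
      refine Complex.norm_deriv_le_of_forall_mem_sphere_norm_le hδ
        (differentiable_expPoly ω q).diffContOnCl fun x hx ↦ hN x ?_
      rw [mem_sphere_iff_norm] at hx
      have : x = (x - y) + y := by ring
      rw [this, hD]
      refine (norm_add_le _ _).trans ?_
      linarith
    have h2 : ‖expPoly ω q y‖ ≤ N := hN y (by rw [hD]; linarith)
    have h3 : 0 ≤ Ω := (norm_nonneg _).trans (hω v)
    calc ‖deriv (expPoly ω q) y - ω v * expPoly ω q y‖
        ≤ ‖deriv (expPoly ω q) y‖ + ‖ω v‖ * ‖expPoly ω q y‖ := by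
          rw [← norm_mul]; exact norm_sub_le _ _
      _ ≤ N / δ + Ω * N := by gcongr; exact hω v
      _ = (1 / δ + Ω) * N := by ring

/-- Exponential polynomials with distinct frequencies vanish only if all their coefficients do. -/
lemma eq_zero_of_expPoly_eq_zero {ω : ι → ℂ} (hω : Function.Injective ω) {D : ℕ}
    {q : ι → ℂ[X]} {d : ι → ℕ} (hd : ∑ u, d u = D) (hq : ∀ u m, d u ≤ m → (q u).coeff m = 0)
    (h : ∀ z, expPoly ω q z = 0) (u : ι) : q u = 0 := by
  classical
  induction D generalizing q d u with
  | zero =>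
    ext m
    exact hq u m (by rw [(sum_eq_zero_iff.1 hd) u (mem_univ u)]; exact Nat.zero_le m)
  | succ D ih =>
    obtain ⟨v, -, hv⟩ := exists_pos_and_sum_update_of_sum_eq_succ hd
    have hstep : ∀ u, derivative (q u) + C (ω u - ω v) * q u = 0 := by
      refine ih hv (coeff_derivative_add_C_sub_mul_eq_zero hq) fun z ↦ ?_
      have h0 : expPoly ω q = fun _ ↦ 0 := funext h
      rw [← deriv_expPoly_sub_mul, h0]
      simp
    have hne : ∀ u, u ≠ v → q u = 0 := by
      intro u huv
      by_contra hqu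
      have ha : ω u - ω v ≠ 0 := sub_ne_zero.2 fun h ↦ huv (hω h)
      have h1 : C (ω u - ω v) * q u = -derivative (q u) := by
        linear_combination hstep u
      have h2 := congrArg degree h1
      rw [degree_C_mul ha, degree_neg] at h2
      exact absurd (degree_derivative_lt hqu) (by rw [h2]; exact lt_irrefl _)
    by_cases huv : u = v
    · subst huv
      have h1 : derivative (q u) = 0 := by simpa using hstep u
      have h2 := h 0
      rw [expPoly, sum_eq_single u (fun w _ hw ↦ by simp [hne w hw]) (by simp)] at h2
      rw [eq_C_of_derivative_eq_zero h1] at h2 ⊢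
      simpa using h2
    · exact hne u huv

/-- A zero estimate for exponential polynomials. -/
lemma two_pow_le_of_expPoly_order {ω : ι → ℂ} (hinj : Function.Injective ω) {Ω : ℝ}
    (hω : ∀ u, ‖ω u‖ ≤ Ω) {q : ι → ℂ[X]} {d : ℕ} (hq : ∀ u m, d ≤ m → (q u).coeff m = 0)
    (hq0 : q ≠ 0) {k : ℕ} {s : Finset ℂ} {r : ℝ} (hr : 0 < r) (hsr : ∀ c ∈ s, ‖c‖ ≤ r)
    (hs : ∀ c ∈ s, (k : ℕ∞) ≤ analyticOrderAt (expPoly ω q) c) :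
    (2 : ℝ) ^ (k * #s) ≤ Real.exp (10 * Ω * r + 5 * (Fintype.card ι * d : ℕ)) := by
  have hd : ∑ _u : ι, d = Fintype.card ι * d := by simp
  have hDpos : 0 < Fintype.card ι * d := by
    rcases Nat.eq_zero_or_pos (Fintype.card ι * d) with h | h
    · exfalso
      rw [h] at hd
      refine hq0 (funext fun u ↦ ?_)
      ext m
      exact hq u m (by rw [(sum_eq_zero_iff.1 hd) u (mem_univ u)]; exact Nat.zero_le m)
    · exact h
  obtain ⟨w, hw, hmax⟩ := (isCompact_closedBall (0 : ℂ) r).exists_isMaxOn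
    ⟨0, by simpa using hr.le⟩ (differentiable_expPoly ω q).continuous.norm.continuousOn
  rw [mem_closedBall_zero_iff] at hw
  set D : ℕ := Fintype.card ι * d with hDdef
  have hD : (0 : ℝ) < D := by exact_mod_cast hDpos
  have hδ : 0 < r / D := by positivity
  have hbound := norm_expPoly_le hω hδ hd hq (N := ‖expPoly ω q w‖) fun z hz ↦ by
    refine hmax ?_
    rw [mem_closedBall_zero_iff]
    rwa [div_mul_cancel₀ _ hD.ne'] at hz
  have hwpos : 0 < ‖expPoly ω q w‖ := by
    refine lt_of_le_of_ne (norm_nonneg _) fun h0 ↦ hq0 (funext fun u ↦ ?_)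
    refine eq_zero_of_expPoly_eq_zero hinj hd hq (fun z ↦ ?_) u
    have := hbound z
    rw [← h0, zero_mul] at this
    exact norm_le_zero_iff.1 this
  have hschwarz := norm_le_div_two_pow_of_analyticOrderAt (differentiable_expPoly ω q) hs hr hsr
    (B := ‖expPoly ω q w‖ * Real.exp (10 * Ω * r + 5 * D)) (fun z hz ↦ by
      refine (hbound z).trans (le_of_eq ?_)
      rw [hz]
      congr 2
      field_simp
      ring) hw
  rw [le_div_iff₀ (by positivity)] at hschwarz
  exact le_of_mul_le_mul_left hschwarz hwpos

end ExpPoly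

section OpVal

variable {A : Type*} [CommRing A]

/-- The value at `x` of the polynomial `P(d/dX) X ^ c`. -/
def opVal (P : A[X]) (c : ℕ) (x : A) : A :=
  ∑ j ∈ range (c + 1), P.coeff j * (c.descFactorial j : A) * x ^ (c - j)

lemma opVal_one (c : ℕ) (x : A) : opVal 1 c x = x ^ c := by
  rw [opVal, sum_eq_single 0]
  · simp
  · intro j _ hj
    simp [coeff_one, hj]
  · simp

lemma opVal_add (P Q : A[X]) (c : ℕ) (x : A) : opVal (P + Q) c x = opVal P c x + opVal Q c x := by
  simp only [opVal, coeff_add, ← sum_add_distrib]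
  exact sum_congr rfl fun _ _ ↦ by ring

lemma opVal_C_mul (a : A) (P : A[X]) (c : ℕ) (x : A) : opVal (C a * P) c x = a * opVal P c x := by
  simp only [opVal, coeff_C_mul, mul_sum]
  exact sum_congr rfl fun _ _ ↦ by ring

lemma opVal_X_mul (P : A[X]) (c : ℕ) (x : A) : opVal (X * P) c x = c * opVal P (c - 1) x := by
  rw [opVal, sum_range_succ']
  rcases c with _ | c
  · simp
  · simp only [coeff_X_mul, mul_coeff_zero, coeff_X_zero, zero_mul, add_zero, Nat.add_sub_cancel,
      opVal, mul_sum, Nat.succ_descFactorial_succ]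
    refine sum_congr rfl fun j _ ↦ ?_
    rw [Nat.add_sub_add_right]
    push_cast
    ring

lemma map_opVal {A' : Type*} [CommRing A'] (φ : A →+* A') (P : A[X]) (c : ℕ) (x : A) :
    φ (opVal P c x) = opVal (P.map φ) c (φ x) := by
  simp [opVal, map_sum]

lemma hasDerivAt_opVal (P : ℂ[X]) (c : ℕ) (x : ℂ) :
    HasDerivAt (opVal P c) (opVal (X * P) c x) x := by
  rw [opVal_X_mul]
  unfold opVal
  rw [mul_sum]
  rcases c with _ | c
  · simpa using hasDerivAt_const x (P.coeff 0)
  · have h := HasDerivAt.fun_sum (u := range (c + 1 + 1)) fun j _ ↦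
      (hasDerivAt_pow (c + 1 - j) x).const_mul (P.coeff j * ((c + 1).descFactorial j : ℂ))
    convert! h using 1
    rw [sum_range_succ _ (c + 1)]
    simp only [Nat.add_sub_cancel, Nat.sub_self, Nat.cast_zero, zero_mul, mul_zero, add_zero]
    refine sum_congr rfl fun j hj ↦ ?_
    have hj' : j ≤ c := Nat.lt_succ_iff.1 (mem_range.1 hj)
    have h1 : ((c + 1 : ℕ) : ℂ) * (c.descFactorial j : ℂ) =
        ((c + 1 - j : ℕ) : ℂ) * ((c + 1).descFactorial j : ℂ) := by
      rw [← Nat.cast_mul, ← Nat.cast_mul, ← Nat.succ_descFactorial_succ, Nat.descFactorial_succ]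
    have h2 : c + 1 - j - 1 = c - j := by omega
    rw [h2]
    linear_combination (P.coeff j * x ^ (c - j)) * h1

variable {ι : Type*} [Fintype ι]

/-- The polynomial `∏ i, (b i X + u i) ^ m i`. -/
noncomputable def opPoly (b : ι → A) (u m : ι → ℕ) : A[X] :=
  ∏ i, (C (b i) * X + C (u i : A)) ^ m i

lemma map_opPoly {A' : Type*} [CommRing A'] (φ : A →+* A') (b : ι → A) (u m : ι → ℕ) :
    (opPoly b u m).map φ = opPoly (φ ∘ b) u m := by
  simp [opPoly, Polynomial.map_prod]

lemma opPoly_zero (b : ι → A) (u : ι → ℕ) : opPoly b u 0 = 1 := by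
  simp [opPoly]

lemma opPoly_add_single [DecidableEq ι] (b : ι → A) (u m : ι → ℕ) (i : ι) :
    opPoly b u (m + Pi.single i 1) = (C (b i) * X + C (u i : A)) * opPoly b u m := by
  simp only [opPoly, Pi.add_apply, pow_add, prod_mul_distrib]
  rw [mul_comm]
  congr 1
  rw [prod_eq_single i]
  · simp
  · intro j _ hj
    simp [hj]
  · simp

lemma norm_opVal_opPoly_le {b : ι → ℂ} {B : ℝ} (hB : 1 ≤ B) (hb : ∀ i, ‖b i‖ ≤ B) {L : ℕ}
    (hL : 1 ≤ L) {u : ι → ℕ} (hu : ∀ i, u i ≤ L) (m : ι → ℕ) {c : ℕ} (hc : c ≤ L) {x : ℂ} {Y : ℝ}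
    (hY : 1 ≤ Y) (hx : ‖x‖ ≤ Y) :
    ‖opVal (opPoly b u m) c x‖ ≤ (2 * B * L) ^ (∑ i, m i) * Y ^ L := by
  have hL' : (1 : ℝ) ≤ L := by exact_mod_cast hL
  have key : ∀ P : ℂ[X], ∀ N : ℝ, 0 ≤ N → (∀ c ≤ L, ‖opVal P c x‖ ≤ N * Y ^ L) →
      ∀ i, ∀ c ≤ L, ‖opVal ((C (b i) * X + C (u i : ℂ)) * P) c x‖ ≤ 2 * B * L * N * Y ^ L := by
    intro P N hN hP i c hc
    have hBL : 0 ≤ B * L := by positivity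
    rw [add_mul, mul_assoc, opVal_add, opVal_C_mul, opVal_C_mul, opVal_X_mul]
    calc ‖b i * (c * opVal P (c - 1) x) + u i * opVal P c x‖
        ≤ ‖b i‖ * (c * ‖opVal P (c - 1) x‖) + u i * ‖opVal P c x‖ := by
          refine (norm_add_le _ _).trans (le_of_eq ?_)
          simp
      _ ≤ B * (L * (N * Y ^ L)) + (B * L) * (N * Y ^ L) := by
          gcongr
          · exact hb i
          · exact hP _ (by omega)
          · have h1 : (u i : ℝ) ≤ L := by exact_mod_cast hu i
            nlinarith
          · exact hP c hc
      _ = 2 * B * L * N * Y ^ L := by ring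
  have hpow : ∀ (i : ι) (e : ℕ) (P : ℂ[X]) (N : ℝ), 0 ≤ N → (∀ c ≤ L, ‖opVal P c x‖ ≤ N * Y ^ L) →
      ∀ c ≤ L, ‖opVal ((C (b i) * X + C (u i : ℂ)) ^ e * P) c x‖ ≤
        (2 * B * L) ^ e * N * Y ^ L := by
    intro i e P N hN hP
    induction e with
    | zero => simpa using hP
    | succ e ih =>
      intro c hc
      rw [pow_succ', mul_assoc]
      have := key _ _ (by positivity) ih i c hc
      refine this.trans (le_of_eq (by ring))
  have hprod : ∀ s : Finset ι, ∀ c ≤ L,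
      ‖opVal (∏ i ∈ s, (C (b i) * X + C (u i : ℂ)) ^ m i) c x‖ ≤
        (2 * B * L) ^ (∑ i ∈ s, m i) * Y ^ L := by
    classical
    intro s
    induction s using Finset.induction_on with
    | empty =>
      intro c hc
      simp only [prod_empty, sum_empty, pow_zero, one_mul, opVal_one, norm_pow]
      calc ‖x‖ ^ c ≤ Y ^ c := by gcongr
        _ ≤ Y ^ L := pow_le_pow_right₀ hY hc
    | insert i s hi ih =>
      intro c hc
      rw [prod_insert hi, sum_insert hi, pow_add]
      exact hpow i (m i) _ _ (by positivity) ih c hc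
  exact hprod univ c hc

end OpVal

section AuxFun

variable {ι : Type*} [Fintype ι] {L : ℕ}

/-- The frequency `∑ i, u i * ℓ i`. -/
def freq (ℓ : ι → ℂ) (u : ι → Fin L) : ℂ := ∑ i, (u i : ℂ) * ℓ i

lemma norm_freq_le (ℓ : ι → ℂ) (u : ι → Fin L) : ‖freq ℓ u‖ ≤ L * ∑ i, ‖ℓ i‖ := by
  rw [freq, mul_sum]
  refine (norm_sum_le _ _).trans (sum_le_sum fun i _ ↦ ?_)
  rw [norm_mul, Complex.norm_natCast]
  gcongr
  exact (u i).is_lt.le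

variable [DecidableEq ι]

/-- The restriction to the line spanned by `ℓ` of the derivative of order `m` of the function
`∑ p (c, u) (∑ i, b i * y i) ^ c * exp (∑ i, u i * y i)` of `y`. -/
noncomputable def auxFun (ℓ b : ι → ℂ) (β : ℂ) (p : Fin L × (ι → Fin L) → ℂ) (m : ι → ℕ)
    (z : ℂ) : ℂ :=
  ∑ x, p x * (opVal (opPoly b (fun i ↦ x.2 i) m) x.1 (β * z) * Complex.exp (freq ℓ x.2 * z))

variable {ℓ b : ι → ℂ} {β : ℂ} {p : Fin L × (ι → Fin L) → ℂ}

lemma hasDerivAt_auxFun (hβ : ∑ i, b i * ℓ i = β) (m : ι → ℕ) (z : ℂ) :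
    HasDerivAt (auxFun ℓ b β p m) (∑ i, ℓ i * auxFun ℓ b β p (m + Pi.single i 1) z) z := by
  unfold auxFun
  simp_rw [mul_sum]
  rw [sum_comm]
  refine HasDerivAt.fun_sum fun x _ ↦ ?_
  set P := opPoly b (fun i ↦ (x.2 i : ℕ)) m with hP
  have h1 : HasDerivAt (fun z ↦ β * z) (β * 1) z := (hasDerivAt_id z).const_mul β
  have h2 : HasDerivAt (fun z ↦ freq ℓ x.2 * z) (freq ℓ x.2 * 1) z :=
    (hasDerivAt_id z).const_mul _
  have h3 : HasDerivAt (fun z ↦ opVal P x.1 (β * z)) (opVal (X * P) x.1 (β * z) * (β * 1)) z :=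
    (hasDerivAt_opVal P x.1 (β * z)).comp z h1
  convert! (h3.mul h2.cexp).const_mul (p x) using 1
  have h4 : ∀ i, opVal (opPoly b (fun i ↦ (x.2 i : ℕ)) (m + Pi.single i 1)) x.1 (β * z) =
      b i * opVal (X * P) x.1 (β * z) + (x.2 i : ℂ) * opVal P x.1 (β * z) := by
    intro i
    rw [opPoly_add_single, add_mul, opVal_add, mul_assoc, opVal_C_mul, opVal_C_mul]
  simp_rw [h4]
  have h5 : ∑ i, ℓ i * (b i * opVal (X * P) x.1 (β * z) + (x.2 i : ℂ) * opVal P x.1 (β * z)) =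
      β * opVal (X * P) x.1 (β * z) + freq ℓ x.2 * opVal P x.1 (β * z) := by
    generalize opVal (X * P) x.1 (β * z) = v, opVal P x.1 (β * z) = w
    rw [← hβ, freq, sum_mul, sum_mul, ← sum_add_distrib]
    exact sum_congr rfl fun i _ ↦ by ring
  calc _ = p x * ((∑ i, ℓ i * (b i * opVal (X * P) x.1 (β * z) +
          (x.2 i : ℂ) * opVal P x.1 (β * z))) * Complex.exp (freq ℓ x.2 * z)) := by
        rw [sum_mul, mul_sum]
        exact sum_congr rfl fun i _ ↦ by ring
    _ = _ := by rw [h5]; ring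

lemma differentiable_auxFun (hβ : ∑ i, b i * ℓ i = β) (m : ι → ℕ) :
    Differentiable ℂ (auxFun ℓ b β p m) :=
  fun z ↦ (hasDerivAt_auxFun hβ m z).differentiableAt

lemma iteratedDeriv_auxFun_eq_zero (hβ : ∑ i, b i * ℓ i = β) {k : ℕ} {z : ℂ}
    (h : ∀ m : ι → ℕ, (∀ i, m i < k) → auxFun ℓ b β p m z = 0) (j : ℕ) (m : ι → ℕ)
    (hm : ∀ i, m i + j < k) : iteratedDeriv j (auxFun ℓ b β p m) z = 0 := by
  induction j generalizing m with
  | zero => simpa using h m hm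
  | succ j ih =>
    have hd : deriv (auxFun ℓ b β p m) =
        fun z ↦ ∑ i, ℓ i * auxFun ℓ b β p (m + Pi.single i 1) z :=
      funext fun z ↦ (hasDerivAt_auxFun hβ m z).deriv
    have hc : ∀ m, ContDiff ℂ j (auxFun ℓ b β p m) := fun m ↦
      (differentiable_auxFun hβ m).contDiff
    rw [iteratedDeriv_succ', hd, iteratedDeriv_fun_sum fun i _ ↦
      (contDiff_const.mul (hc _)).contDiffAt]
    refine sum_eq_zero fun i _ ↦ ?_
    rw [iteratedDeriv_const_mul_field, ih, mul_zero]
    intro i'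
    have := hm i'
    by_cases hi : i' = i
    · subst hi
      simp
      omega
    · simp [hi]
      omega

lemma le_analyticOrderAt_auxFun (hβ : ∑ i, b i * ℓ i = β) {k : ℕ} {z : ℂ}
    (h : ∀ m : ι → ℕ, (∀ i, m i < k) → auxFun ℓ b β p m z = 0) (j : ℕ) (m : ι → ℕ)
    (hm : ∀ i, m i + j ≤ k) : (j : ℕ∞) ≤ analyticOrderAt (auxFun ℓ b β p m) z := by
  rw [natCast_le_analyticOrderAt_iff_iteratedDeriv_eq_zero
    ((differentiable_auxFun hβ m).analyticAt z)]
  exact fun i hi ↦ iteratedDeriv_auxFun_eq_zero hβ h i m fun i' ↦ by have := hm i'; omega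

lemma auxFun_zero_eq_expPoly :
    auxFun ℓ b β p 0 = expPoly (freq ℓ)
      (fun u ↦ ∑ c : Fin L, C (p (c, u) * β ^ (c : ℕ)) * X ^ (c : ℕ)) := by
  funext z
  rw [auxFun, expPoly, Fintype.sum_prod_type_right]
  refine sum_congr rfl fun u _ ↦ ?_
  rw [eval_finsetSum, sum_mul]
  refine sum_congr rfl fun c _ ↦ ?_
  simp [opPoly_zero, opVal_one, mul_pow]
  ring

end AuxFun

section NumberFieldLemmas

variable (K : Type*) [Field K] [NumberField K]

/-- Siegel's lemma for systems with at least twice as many unknowns as equations. -/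
lemma exists_siegel_const : ∃ c : ℝ, 1 ≤ c ∧ ∀ {α β : Type} [Fintype α] [Fintype β]
    (a : Matrix α β (𝓞 K)) (B : ℝ), 0 < Fintype.card α →
    2 * Fintype.card α ≤ Fintype.card β → 1 ≤ B →
    (∀ k l, house (algebraMap (𝓞 K) K (a k l)) ≤ B) →
    ∃ ξ : β → 𝓞 K, ξ ≠ 0 ∧ (∀ k, ∑ l, a k l * ξ l = 0) ∧
      ∀ l, house (algebraMap (𝓞 K) K (ξ l)) ≤ c * Fintype.card β * B := by
  classical
  obtain ⟨c, hc⟩ : ∃ c : ℝ, ∀ {α β : Type} [Fintype α] [Fintype β]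
      (a : Matrix α β (𝓞 K)) (B : ℝ) (p q : ℕ), 0 < p → p < q → Fintype.card α = p →
      Fintype.card β = q → a ≠ 0 →
      (∀ k l, house (algebraMap (𝓞 K) K (a k l)) ≤ B) →
      ∃ ξ : β → 𝓞 K, ξ ≠ 0 ∧ a.mulVec ξ = 0 ∧
        ∀ l, house (ξ l).1 ≤ c * ((c * q * B) ^ ((p : ℝ) / (q - p))) :=
    ⟨_, fun a B p q hp hpq hα hβ ha hB ↦
      house.exists_ne_zero_int_vec_house_le K a ha hp hpq hβ hB hα⟩
  set e : ℝ := max |c| 1 with he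
  have he1 : 1 ≤ e := le_max_right _ _
  refine ⟨e * e, by nlinarith, fun {α β} _ _ a B hα hαβ hB ha ↦ ?_⟩
  have hβ : 1 ≤ Fintype.card β := by omega
  have hβ' : (1 : ℝ) ≤ Fintype.card β := by exact_mod_cast hβ
  have hbig : 1 ≤ e * Fintype.card β * B := by
    have := one_le_mul_of_one_le_of_one_le he1 hβ'
    exact one_le_mul_of_one_le_of_one_le this hB
  by_cases ha0 : a = 0
  · obtain ⟨l₀⟩ : Nonempty β := Fintype.card_pos_iff.1 hβ
    refine ⟨fun _ ↦ 1, fun h ↦ one_ne_zero (congrFun h l₀), by simp [ha0], fun l ↦ ?_⟩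
    have h1 : house (algebraMap (𝓞 K) K 1) = 1 := by
      have := house_intCast (K := K) 1
      simpa using this
    rw [h1]
    nlinarith
  · obtain ⟨ξ, hξ, hmul, hbound⟩ := hc a B _ _ hα (by omega) rfl rfl ha0 ha
    refine ⟨ξ, hξ, fun k ↦ congrFun hmul k, fun l ↦ ?_⟩
    have hexp1 : (Fintype.card α : ℝ) / (Fintype.card β - Fintype.card α) ≤ 1 := by
      have : (2 : ℝ) * Fintype.card α ≤ Fintype.card β := by exact_mod_cast hαβ
      have h0 : (0 : ℝ) < Fintype.card α := by exact_mod_cast hα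
      rw [div_le_one (by linarith)]
      linarith
    have hexp0 : 0 ≤ (Fintype.card α : ℝ) / (Fintype.card β - Fintype.card α) := by
      have : (2 : ℝ) * Fintype.card α ≤ Fintype.card β := by exact_mod_cast hαβ
      have h0 : (0 : ℝ) < Fintype.card α := by exact_mod_cast hα
      exact div_nonneg h0.le (by linarith)
    refine (hbound l).trans ?_
    calc _ ≤ e * (e * Fintype.card β * B) := by
          have h1 : |c * Fintype.card β * B| ≤ e * Fintype.card β * B := by
            rw [abs_mul, abs_mul, Nat.abs_cast, abs_of_nonneg (zero_le_one.trans hB)]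
            gcongr
            exact le_max_left _ _
          have h2 : |(c * Fintype.card β * B) ^
              ((Fintype.card α : ℝ) / (Fintype.card β - Fintype.card α))| ≤
              e * Fintype.card β * B := by
            calc _ ≤ |c * Fintype.card β * B| ^
                  ((Fintype.card α : ℝ) / (Fintype.card β - Fintype.card α)) :=
                  Real.abs_rpow_le_abs_rpow _ _
              _ ≤ (e * Fintype.card β * B) ^
                  ((Fintype.card α : ℝ) / (Fintype.card β - Fintype.card α)) :=
                  Real.rpow_le_rpow (abs_nonneg _) h1 hexp0
              _ ≤ (e * Fintype.card β * B) ^ (1 : ℝ) :=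
                  Real.rpow_le_rpow_of_exponent_le hbig hexp1
              _ = _ := Real.rpow_one _
          refine (le_abs_self _).trans ?_
          rw [abs_mul]
          gcongr
          exact le_max_left _ _
      _ = _ := by ring

variable {K}

/-- The Liouville inequality for algebraic integers. -/
lemma one_le_norm_mul_pow_of_house_le {x : 𝓞 K} (hx : x ≠ 0) {H : ℝ} (hH1 : 1 ≤ H)
    (hH : house (algebraMap (𝓞 K) K x) ≤ H) (σ : K →+* ℂ) :
    1 ≤ ‖σ (algebraMap (𝓞 K) K x)‖ * H ^ Module.finrank ℚ K := by
  have h1 : (1 : ℝ) ≤ ‖Algebra.norm ℚ (algebraMap (𝓞 K) K x)‖ := by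
    have h2 : Algebra.norm ℤ x ≠ 0 := by rwa [Ne, Algebra.norm_eq_zero_iff]
    have h3 : (1 : ℤ) ≤ |Algebra.norm ℤ x| := Int.one_le_abs h2
    have h4 := Algebra.coe_norm_int x
    rw [← h4]
    rw [← Rat.norm_cast_real, Rat.cast_intCast, Real.norm_eq_abs]
    exact_mod_cast h3
  refine h1.trans ((norm_norm_le_norm_mul_house_pow _ σ).trans ?_)
  gcongr
  calc house (algebraMap (𝓞 K) K x) ^ (Module.finrank ℚ K - 1)
      ≤ H ^ (Module.finrank ℚ K - 1) := by gcongr; exact house_nonneg _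
    _ ≤ H ^ Module.finrank ℚ K := pow_le_pow_right₀ hH1 (Nat.sub_le _ _)

lemma house_le_of_forall_norm_le {x : K} {B : ℝ} (hx : ∀ σ : K →+* ℂ, ‖σ x‖ ≤ B) :
    house x ≤ B := by
  have : Nonempty (K →+* ℂ) := inferInstance
  rw [house, pi_norm_le_iff_of_nonempty]
  exact hx

end NumberFieldLemmas

section Coefficients

variable {A : Type*} [CommRing A] {ι : Type*} [Fintype ι] {L : ℕ}

/-- The algebraic number by which the unknown of index `x` is multiplied in the value at `l` of
the derivative of order `m` of the auxiliary function. -/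
noncomputable def auxCoeff (a b : ι → A) (β : A) (m : ι → ℕ) (l : ℕ) (x : Fin L × (ι → Fin L)) :
    A :=
  opVal (opPoly b (fun i ↦ x.2 i) m) x.1 (β * l) * ∏ i, a i ^ ((x.2 i : ℕ) * l)

lemma map_auxCoeff {A' : Type*} [CommRing A'] (φ : A →+* A') (a b : ι → A) (β : A) (m : ι → ℕ)
    (l : ℕ) (x : Fin L × (ι → Fin L)) :
    φ (auxCoeff a b β m l x) = auxCoeff (φ ∘ a) (φ ∘ b) (φ β) m l x := by
  simp [auxCoeff, map_opVal, map_opPoly]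

lemma sum_mul_auxCoeff [DecidableEq ι] {ℓ a : ι → ℂ} (hℓ : ∀ i, Complex.exp (ℓ i) = a i)
    (b : ι → ℂ) (β : ℂ) (p : Fin L × (ι → Fin L) → ℂ) (m : ι → ℕ) (l : ℕ) :
    ∑ x, p x * auxCoeff a b β m l x = auxFun ℓ b β p m l := by
  refine sum_congr rfl fun x _ ↦ ?_
  rw [auxCoeff]
  congr 2
  rw [freq, sum_mul, Complex.exp_sum]
  refine prod_congr rfl fun i _ ↦ ?_
  rw [← hℓ i, ← Complex.exp_nat_mul]
  push_cast
  ring_nf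

lemma norm_opVal_opPoly_le_exp {b : ι → ℂ} {β : ℂ} {c : ℝ} (hc : 1 ≤ c)
    (hb : ∀ i, ‖b i‖ ≤ Real.exp c) (hβ : ‖β‖ ≤ Real.exp c) {k : ℕ} (hk : 3 ≤ k) (hLk : L ≤ k)
    {m : ι → ℕ} (hm : ∀ i, m i < k) (x : Fin L × (ι → Fin L)) {ρ : ℕ} (hρ : 1 ≤ ρ) {z : ℂ}
    (hz : ‖z‖ ≤ ρ) :
    ‖opVal (opPoly b (fun i ↦ x.2 i) m) x.1 (β * z)‖ ≤
      Real.exp (3 * Fintype.card ι * c * (k * Real.log k) + 2 * c * (L * ρ)) := by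
  have hL : 1 ≤ L := Nat.one_le_iff_ne_zero.2 fun h ↦ by
    subst h; exact x.1.elim0
  have hρ' : (1 : ℝ) ≤ ρ := by exact_mod_cast hρ
  have hB : 1 ≤ Real.exp c := Real.one_le_exp (by linarith)
  have hL' : (1 : ℝ) ≤ L := by exact_mod_cast hL
  have hLk' : (L : ℝ) ≤ k := by exact_mod_cast hLk
  have hk' : (3 : ℝ) ≤ k := by exact_mod_cast hk
  have hlog : 1 ≤ Real.log k := by
    rw [Real.le_log_iff_exp_le (by linarith)]
    exact (Real.exp_one_lt_three.le).trans hk'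
  have h1 := norm_opVal_opPoly_le hB hb hL (fun i ↦ (x.2 i).is_lt.le) m x.1.is_lt.le
    (Y := Real.exp c * ρ) (one_le_mul_of_one_le_of_one_le hB hρ') (x := β * z)
    (by rw [norm_mul]; gcongr)
  refine h1.trans ?_
  rw [Real.exp_add]
  have h2 : 2 * Real.exp c * L ≤ Real.exp (3 * c * Real.log k) := by
    have h3 : (2 : ℝ) ≤ Real.exp c := by
      have := Real.add_one_le_exp c
      linarith
    calc 2 * Real.exp c * L ≤ Real.exp c * Real.exp c * Real.exp (Real.log k) := by
          rw [Real.exp_log (by linarith)]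
          gcongr
      _ = Real.exp (c + c + Real.log k) := by rw [Real.exp_add, Real.exp_add]
      _ ≤ _ := by
          gcongr
          nlinarith
  have h4 : (1 : ℝ) ≤ 2 * Real.exp c * L := by nlinarith
  have h5 : ∑ i, m i ≤ Fintype.card ι * k := by
    calc ∑ i, m i ≤ ∑ _i : ι, k := sum_le_sum fun i _ ↦ (hm i).le
      _ = _ := by simp
  refine mul_le_mul ?_ ?_ (by positivity) (by positivity)
  · calc (2 * Real.exp c * L) ^ (∑ i, m i) ≤ (2 * Real.exp c * L) ^ (Fintype.card ι * k) :=
          pow_le_pow_right₀ h4 h5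
      _ ≤ (Real.exp (3 * c * Real.log k)) ^ (Fintype.card ι * k) := by gcongr
      _ = _ := by
          rw [← Real.exp_nat_mul]
          push_cast
          ring_nf
  · have h6 : Real.exp c * ρ ≤ Real.exp (2 * c * ρ) := by
      have h7 : (ρ : ℝ) ≤ Real.exp (c * ρ) := by
        have := Real.add_one_le_exp (c * ρ)
        nlinarith
      calc Real.exp c * ρ ≤ Real.exp (c * ρ) * Real.exp (c * ρ) := by
            gcongr
            nlinarith
        _ = _ := by rw [← Real.exp_add]; ring_nf
    calc (Real.exp c * ρ) ^ L ≤ (Real.exp (2 * c * ρ)) ^ L := by gcongr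
      _ = _ := by
          rw [← Real.exp_nat_mul]
          ring_nf

lemma norm_auxCoeff_le {a b : ι → ℂ} {β : ℂ} {c : ℝ} (hc : 1 ≤ c)
    (ha : ∀ i, ‖a i‖ ≤ Real.exp c) (hb : ∀ i, ‖b i‖ ≤ Real.exp c) (hβ : ‖β‖ ≤ Real.exp c)
    {k : ℕ} (hk : 3 ≤ k) (hLk : L ≤ k) {m : ι → ℕ} (hm : ∀ i, m i < k)
    (x : Fin L × (ι → Fin L)) {ρ l : ℕ} (hρ : 1 ≤ ρ) (hl : l ≤ ρ) :
    ‖auxCoeff a b β m l x‖ ≤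
      Real.exp ((3 * Fintype.card ι + 2) * c * (k * Real.log k + L * ρ)) := by
  have hlog : 0 ≤ Real.log k := Real.log_natCast_nonneg k
  have h1 := norm_opVal_opPoly_le_exp hc hb hβ hk hLk hm x hρ (z := (l : ℂ))
    (by rw [Complex.norm_natCast]; exact_mod_cast hl)
  have h2 : ‖∏ i, a i ^ ((x.2 i : ℕ) * l)‖ ≤ Real.exp (Fintype.card ι * c * (L * ρ)) := by
    rw [norm_prod]
    calc ∏ i, ‖a i ^ ((x.2 i : ℕ) * l)‖ ≤ ∏ _i : ι, Real.exp (c * (L * ρ)) := by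
          refine prod_le_prod (fun _ _ ↦ norm_nonneg _) fun i _ ↦ ?_
          rw [norm_pow]
          calc ‖a i‖ ^ ((x.2 i : ℕ) * l) ≤ Real.exp c ^ ((x.2 i : ℕ) * l) := by
                gcongr
                exact ha i
            _ ≤ Real.exp c ^ (L * ρ) :=
                pow_le_pow_right₀ (Real.one_le_exp (by linarith))
                  (Nat.mul_le_mul (x.2 i).is_lt.le hl)
            _ = _ := by
                rw [← Real.exp_nat_mul]
                push_cast
                ring_nf
      _ = _ := by
          rw [prod_const, ← Real.exp_nat_mul, card_univ]
          ring_nf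
  rw [auxCoeff, norm_mul]
  calc _ ≤ Real.exp (3 * Fintype.card ι * c * (k * Real.log k) + 2 * c * (L * ρ)) *
        Real.exp (Fintype.card ι * c * (L * ρ)) := by gcongr
    _ ≤ _ := by
      rw [← Real.exp_add]
      gcongr
      have : 0 ≤ c * (k * Real.log k) := by positivity
      have : 0 ≤ Fintype.card ι * (c * (L * ρ)) := by positivity
      nlinarith

lemma norm_auxFun_le [DecidableEq ι] {ℓ b : ι → ℂ} {β : ℂ} {c P : ℝ} (hc : 1 ≤ c)
    (hℓ : ∑ i, ‖ℓ i‖ ≤ c) (hb : ∀ i, ‖b i‖ ≤ Real.exp c) (hβ : ‖β‖ ≤ Real.exp c)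
    {k : ℕ} (hk : 3 ≤ k) (hLk : L ≤ k) {m : ι → ℕ} (hm : ∀ i, m i < k)
    {p : Fin L × (ι → Fin L) → ℂ} (hp : ∀ x, ‖p x‖ ≤ P) {ρ : ℕ} (hρ : 1 ≤ ρ) {z : ℂ}
    (hz : ‖z‖ ≤ ρ) :
    ‖auxFun ℓ b β p m z‖ ≤ (L : ℝ) ^ (Fintype.card ι + 1) * (P *
      Real.exp ((3 * Fintype.card ι + 3) * c * (k * Real.log k + L * ρ))) := by
  have hlog : 0 ≤ Real.log k := Real.log_natCast_nonneg k
  rw [auxFun]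
  refine (norm_sum_le _ _).trans ?_
  have hcard : (L : ℝ) ^ (Fintype.card ι + 1) =
      (#(univ : Finset (Fin L × (ι → Fin L))) : ℝ) := by
    rw [card_univ]
    simp
    ring
  rw [hcard, ← nsmul_eq_mul]
  refine sum_le_card_nsmul _ _ _ fun x _ ↦ ?_
  rw [norm_mul, norm_mul]
  have h1 := norm_opVal_opPoly_le_exp hc hb hβ hk hLk hm x hρ hz
  have h2 : ‖Complex.exp (freq ℓ x.2 * z)‖ ≤ Real.exp (c * (L * ρ)) := by
    rw [Complex.norm_exp]
    gcongr
    calc (freq ℓ x.2 * z).re ≤ ‖freq ℓ x.2 * z‖ := Complex.re_le_norm _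
      _ ≤ (L * c) * ρ := by
          rw [norm_mul]
          gcongr
          exact (norm_freq_le ℓ x.2).trans (by gcongr)
      _ = _ := by ring
  have hP : 0 ≤ P := (norm_nonneg _).trans (hp x)
  calc _ ≤ P * (Real.exp (3 * Fintype.card ι * c * (k * Real.log k) + 2 * c * (L * ρ)) *
        Real.exp (c * (L * ρ))) := by
        gcongr
        exact hp x
    _ ≤ _ := by
      rw [← Real.exp_add]
      gcongr
      have : 0 ≤ c * (k * Real.log k) := by positivity
      have : 0 ≤ Fintype.card ι * (c * (L * ρ)) := by positivity
      nlinarith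

end Coefficients

section Extrapolation

variable {K : Type*} [Field K] [NumberField K] {ι : Type*} [Fintype ι] [DecidableEq ι] {L : ℕ}

/-- One extrapolation step: more zeros are gained at the cost of half of the multiplicity. -/
lemma auxSum_eq_zero_of_lt {σ : K →+* ℂ} {ℓ b : ι → ℂ} {β : ℂ} {p : Fin L × (ι → Fin L) → ℂ}
    (hβ : ∑ i, b i * ℓ i = β) {F : (ι → ℕ) → ℕ → 𝓞 K} {k : ℕ} {E : ℕ → ℝ} (hE : ∀ ρ, 0 ≤ E ρ)
    (hσ : ∀ m l, σ (algebraMap (𝓞 K) K (F m l)) = auxFun ℓ b β p m l)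
    (hF : ∀ m, (∀ i, m i < k) → ∀ ρ l, 1 ≤ ρ → l ≤ ρ →
      house (algebraMap (𝓞 K) K (F m l)) ≤ Real.exp (E ρ))
    (hA : ∀ m, (∀ i, m i < k) → ∀ ρ z, 1 ≤ ρ → ‖z‖ ≤ (ρ : ℕ) →
      ‖auxFun ℓ b β p m z‖ ≤ Real.exp (E ρ))
    {M R R' : ℕ} (hM : 2 * M ≤ k) (hR : R ≤ R')
    (hnum : E (5 * R') + Module.finrank ℚ K * E R' < M * R * Real.log 2)
    (hzero : ∀ l < R, ∀ m : ι → ℕ, (∀ i, m i < 2 * M) → F m l = 0) :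
    ∀ l < R', ∀ m : ι → ℕ, (∀ i, m i < M) → F m l = 0 := by
  intro l hl m hm
  by_contra hne
  have hR' : 1 ≤ R' := by omega
  have hmk : ∀ i, m i < k := fun i ↦ by have := hm i; omega
  have h1 := one_le_norm_mul_pow_of_house_le hne (Real.one_le_exp (hE R'))
    (hF m hmk R' l hR' hl.le) σ
  have h2 := norm_le_div_two_pow_of_analyticOrderAt (f := auxFun ℓ b β p m)
    (s := (range R).image (fun n : ℕ ↦ (n : ℂ))) (k := M) (r := R') (w := l)
    (B := Real.exp (E (5 * R'))) (differentiable_auxFun hβ m)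
    (by
      intro z hz
      obtain ⟨n, hn, rfl⟩ := mem_image.1 hz
      refine le_analyticOrderAt_auxFun hβ (k := 2 * M) (fun m' hm' ↦ ?_) M m
        fun i ↦ by have := hm i; omega
      rw [← hσ, hzero n (mem_range.1 hn) m' hm']
      simp)
    (by exact_mod_cast hR')
    (by
      intro z hz
      obtain ⟨n, hn, rfl⟩ := mem_image.1 hz
      have := mem_range.1 hn
      rw [Complex.norm_natCast]
      exact_mod_cast (by omega : n ≤ R'))
    (fun z hz ↦ hA m hmk (5 * R') z (by omega) (by rw [hz]; push_cast; rfl))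
    (by rw [Complex.norm_natCast]; exact_mod_cast hl.le)
  rw [card_image_of_injective _ Nat.cast_injective, card_range] at h2
  rw [hσ, ← Real.exp_nat_mul] at h1
  have h3 : (1 : ℝ) ≤ Real.exp (E (5 * R')) / 2 ^ (M * R) *
      Real.exp (Module.finrank ℚ K * E R') := h1.trans (by gcongr)
  have h4 : (2 : ℝ) ^ (M * R) = Real.exp (M * R * Real.log 2) := by
    rw [← Real.rpow_natCast, Real.rpow_def_of_pos two_pos]
    push_cast
    ring_nf
  rw [h4, ← Real.exp_sub, ← Real.exp_add, Real.one_le_exp_iff] at h3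
  linarith

end Extrapolation

lemma freq_injective {ι : Type*} [Fintype ι] {L : ℕ} {ℓ : ι → ℂ} (hℓ : LinearIndependent ℚ ℓ) :
    Function.Injective (freq (L := L) ℓ) := by
  intro u v huv
  have h : ∑ i, ((u i : ℚ) - (v i : ℚ)) • ℓ i = 0 := by
    simp only [freq] at huv
    rw [← sub_eq_zero, ← sum_sub_distrib] at huv
    rw [← huv]
    refine sum_congr rfl fun i _ ↦ ?_
    rw [Algebra.smul_def]
    simp
    ring
  have := Fintype.linearIndependent_iff.1 hℓ _ h
  funext i
  have h2 := sub_eq_zero.1 (this i)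
  exact Fin.ext (by exact_mod_cast h2)

/-- The auxiliary function cannot vanish to high order at many integers. -/
lemma mul_log_two_le_of_auxFun {ι : Type*} [Fintype ι] [DecidableEq ι] {L : ℕ}
    {ℓ b : ι → ℂ} {β : ℂ} {p : Fin L × (ι → Fin L) → ℂ} (hℓ : LinearIndependent ℚ ℓ)
    (hβ : ∑ i, b i * ℓ i = β) (hβ0 : β ≠ 0) (hp : p ≠ 0) {M R : ℕ} (hR : 1 ≤ R)
    (hzero : ∀ l < R, ∀ m : ι → ℕ, (∀ i, m i < M) → auxFun ℓ b β p m l = 0) :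
    M * R * Real.log 2 ≤ 10 * (L * ∑ i, ‖ℓ i‖) * R + 5 * (L : ℝ) ^ (Fintype.card ι + 1) := by
  set q : (ι → Fin L) → ℂ[X] := fun u ↦ ∑ c : Fin L, C (p (c, u) * β ^ (c : ℕ)) * X ^ (c : ℕ)
    with hq
  have hcoeff : ∀ u (c : Fin L), (q u).coeff c = p (c, u) * β ^ (c : ℕ) := by
    intro u c
    simp only [hq, finsetSum_coeff, coeff_C_mul, coeff_X_pow]
    rw [sum_eq_single c]
    · simp
    · intro d _ hd
      rw [if_neg fun h ↦ hd (Fin.ext h.symm), mul_zero]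
    · simp
  have hq0 : q ≠ 0 := by
    intro h
    apply hp
    funext ⟨c, u⟩
    have := hcoeff u c
    rw [h] at this
    simpa [hβ0] using this.symm
  have h := two_pow_le_of_expPoly_order (ω := freq ℓ) (q := q) (d := L) (Ω := L * ∑ i, ‖ℓ i‖)
    (s := (range R).image (fun n : ℕ ↦ (n : ℂ))) (k := M) (r := R)
    (freq_injective hℓ) (norm_freq_le ℓ)
    (by
      intro u m hm
      simp only [hq, finsetSum_coeff, coeff_C_mul, coeff_X_pow]
      refine sum_eq_zero fun d _ ↦ ?_
      have := d.is_lt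
      rw [if_neg (by omega), mul_zero])
    hq0 (by exact_mod_cast hR)
    (by
      intro z hz
      obtain ⟨n, hn, rfl⟩ := mem_image.1 hz
      rw [Complex.norm_natCast]
      exact_mod_cast (mem_range.1 hn).le)
    (by
      intro z hz
      obtain ⟨n, hn, rfl⟩ := mem_image.1 hz
      rw [← auxFun_zero_eq_expPoly]
      exact le_analyticOrderAt_auxFun hβ (hzero n (mem_range.1 hn)) M 0 fun i ↦ by simp)
  rw [card_image_of_injective _ Nat.cast_injective, card_range] at h
  have h4 : (2 : ℝ) ^ (M * R) = Real.exp (M * R * Real.log 2) := by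
    rw [← Real.rpow_natCast, Real.rpow_def_of_pos two_pos]
    push_cast
    ring_nf
  rw [h4, Real.exp_le_exp] at h
  refine h.trans (le_of_eq ?_)
  simp [pow_succ]

lemma eventually_add_mul_log_lt (A B : ℝ) :
    ∀ᶠ T : ℕ in Filter.atTop, A + B * Real.log T < T * Real.log 2 := by
  have h1 : (fun x : ℝ ↦ A + B * Real.log x) =o[Filter.atTop] (fun x : ℝ ↦ x) :=
    (Asymptotics.isLittleO_const_id_atTop A).add
      (Real.isLittleO_log_id_atTop.const_mul_left B)
  have hlog : 0 < Real.log 2 := Real.log_pos one_lt_two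
  have h2 := tendsto_natCast_atTop_atTop (R := ℝ) |>.eventually (h1.def (half_pos hlog))
  filter_upwards [h2, Filter.eventually_ge_atTop 1] with T hT hT1
  have hT' : (1 : ℝ) ≤ T := by exact_mod_cast hT1
  have := (le_abs_self _).trans hT
  rw [Real.norm_of_nonneg (by linarith)] at this
  nlinarith

section Core

variable {K : Type*} [Field K] [NumberField K] {ι : Type} [Fintype ι]

/-- Siegel's lemma applied to the system defining the auxiliary function. -/
lemma exists_aux_solution [DecidableEq ι] (a b : ι → 𝓞 K) (β : 𝓞 K) (σ : K →+* ℂ) (ℓ : ι → ℂ) :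
    ∃ D : ℝ, 0 ≤ D ∧ ∀ T k L : ℕ, 1 ≤ T → 3 ≤ k → 1 ≤ L → L * T ≤ k →
      2 * (T * k ^ Fintype.card ι) ≤ L ^ (Fintype.card ι + 1) →
      ∃ ξ : Fin L × (ι → Fin L) → 𝓞 K, ξ ≠ 0 ∧
        (∀ l < T, ∀ m : ι → ℕ, (∀ i, m i < k) → ∑ x, ξ x * auxCoeff a b β m l x = 0) ∧
        (∀ m : ι → ℕ, (∀ i, m i < k) → ∀ ρ l : ℕ, 1 ≤ ρ → l ≤ ρ →
          house (algebraMap (𝓞 K) K (∑ x, ξ x * auxCoeff a b β m l x)) ≤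
            Real.exp (D * (k * Real.log k + L * ρ))) ∧
        (∀ m : ι → ℕ, (∀ i, m i < k) → ∀ (ρ : ℕ) (z : ℂ), 1 ≤ ρ → ‖z‖ ≤ ρ →
          ‖auxFun ℓ (fun i ↦ σ (algebraMap (𝓞 K) K (b i))) (σ (algebraMap (𝓞 K) K β))
            (fun x ↦ σ (algebraMap (𝓞 K) K (ξ x))) m z‖ ≤
            Real.exp (D * (k * Real.log k + L * ρ))) := by
  set n := Fintype.card ι with hn
  obtain ⟨e, he1, he⟩ := exists_siegel_const K
  set g : 𝓞 K → ℝ := fun x ↦ house (algebraMap (𝓞 K) K x) with hg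
  have hg0 : ∀ x, 0 ≤ g x := fun x ↦ house_nonneg _
  have hgφ : ∀ x (φ : K →+* ℂ), ‖φ (algebraMap (𝓞 K) K x)‖ ≤ g x := fun x φ ↦
    norm_embedding_le_house _ φ
  set c : ℝ := 1 + ∑ i, g (a i) + ∑ i, g (b i) + g β + ∑ i, ‖ℓ i‖ with hcdef
  have hsa : 0 ≤ ∑ i, g (a i) := sum_nonneg fun i _ ↦ hg0 _
  have hsb : 0 ≤ ∑ i, g (b i) := sum_nonneg fun i _ ↦ hg0 _
  have hsl : 0 ≤ ∑ i, ‖ℓ i‖ := sum_nonneg fun i _ ↦ norm_nonneg _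
  have hc : 1 ≤ c := by have := hg0 β; linarith
  have hexp : c ≤ Real.exp c := by have := Real.add_one_le_exp c; linarith
  have ha : ∀ (φ : K →+* ℂ) i, ‖φ (algebraMap (𝓞 K) K (a i))‖ ≤ Real.exp c := fun φ i ↦ by
    have h1 := single_le_sum (f := fun i ↦ g (a i)) (fun i _ ↦ hg0 _) (mem_univ i)
    have h2 := hgφ (a i) φ
    have h3 := hg0 β
    linarith
  have hb : ∀ (φ : K →+* ℂ) i, ‖φ (algebraMap (𝓞 K) K (b i))‖ ≤ Real.exp c := fun φ i ↦ by
    have h1 := single_le_sum (f := fun i ↦ g (b i)) (fun i _ ↦ hg0 _) (mem_univ i)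
    have h2 := hgφ (b i) φ
    have h3 := hg0 β
    linarith
  have hβ : ∀ φ : K →+* ℂ, ‖φ (algebraMap (𝓞 K) K β)‖ ≤ Real.exp c := fun φ ↦ by
    have h2 := hgφ β φ
    linarith
  have hℓc : ∑ i, ‖ℓ i‖ ≤ c := by have := hg0 β; linarith
  set C : ℝ := (3 * n + 3) * c with hC
  have hC0 : 0 ≤ C := by positivity
  refine ⟨e + 2 * (n + 1) + 3 * C, by positivity, fun T k L hT hk hL hLT hcard ↦ ?_⟩
  have hLk : L ≤ k := (Nat.le_mul_of_pos_right L hT).trans hLT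
  have hk' : (3 : ℝ) ≤ k := by exact_mod_cast hk
  have hlog : 1 ≤ Real.log k := by
    rw [Real.le_log_iff_exp_le (by linarith)]
    exact (Real.exp_one_lt_three.le).trans hk'
  set U : ℝ := k * Real.log k with hU
  have hkU : (k : ℝ) ≤ U := by nlinarith
  have hU1 : 1 ≤ U := by linarith
  have hcoeff : ∀ m : ι → ℕ, (∀ i, m i < k) → ∀ (ρ l : ℕ), 1 ≤ ρ → l ≤ ρ → ∀ φ : K →+* ℂ,
      ∀ x : Fin L × (ι → Fin L), ‖φ (algebraMap (𝓞 K) K (auxCoeff a b β m l x))‖ ≤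
        Real.exp (C * (U + L * ρ)) := by
    intro m hm ρ l hρ hl φ x
    have h1 := map_auxCoeff (φ.comp (algebraMap (𝓞 K) K)) a b β m l x
    rw [RingHom.comp_apply] at h1
    rw [h1]
    refine (norm_auxCoeff_le hc (ha φ) (hb φ) (hβ φ) hk hLk hm x hρ hl).trans ?_
    rw [← hn, hC]
    gcongr
    norm_num
  have hcardβ : Fintype.card (Fin L × (ι → Fin L)) = L ^ (n + 1) := by
    simp [pow_succ', hn]
  obtain ⟨ξ, hξ0, hξ, hξle⟩ := he (α := Fin T × (ι → Fin k)) (β := Fin L × (ι → Fin L))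
    (fun y x ↦ auxCoeff a b β (fun i ↦ y.2 i) y.1 x) (Real.exp (2 * C * U))
    (by simp only [Fintype.card_prod, Fintype.card_fun, Fintype.card_fin]; positivity)
    (by
      rw [hcardβ]
      simpa using hcard)
    (Real.one_le_exp (by positivity))
    (fun y x ↦ house_le_of_forall_norm_le fun φ ↦ by
      refine (hcoeff _ (fun i ↦ (y.2 i).is_lt) T y.1 hT y.1.is_lt.le φ x).trans ?_
      have h1 : (L : ℝ) * T ≤ k := by exact_mod_cast hLT
      have h2 : C * (U + L * T) ≤ C * (U + U) := by gcongr; linarith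
      exact Real.exp_le_exp.2 (by linarith))
  have hLpow : (L : ℝ) ^ (n + 1) ≤ Real.exp ((n + 1) * U) := by
    have h1 : (L : ℝ) ≤ Real.exp U := by
      have h2 : (L : ℝ) ≤ k := by exact_mod_cast hLk
      have := Real.add_one_le_exp U
      linarith
    calc (L : ℝ) ^ (n + 1) ≤ Real.exp U ^ (n + 1) := by gcongr
      _ = _ := by rw [← Real.exp_nat_mul]; push_cast; rfl
  set P : ℝ := Real.exp ((e + (n + 1) + 2 * C) * U) with hP
  have hξP : ∀ (φ : K →+* ℂ) x, ‖φ (algebraMap (𝓞 K) K (ξ x))‖ ≤ P := by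
    intro φ x
    refine (hgφ (ξ x) φ).trans ((hξle x).trans ?_)
    rw [hcardβ]
    have h1 : e ≤ Real.exp (e * U) := by
      have := Real.add_one_le_exp (e * U)
      nlinarith
    calc e * ((L ^ (n + 1) : ℕ) : ℝ) * Real.exp (2 * C * U)
        ≤ Real.exp (e * U) * Real.exp ((n + 1) * U) * Real.exp (2 * C * U) := by
          push_cast
          gcongr
      _ = P := by rw [← Real.exp_add, ← Real.exp_add, hP]; ring_nf
  have htotal : ∀ ρ : ℕ, (L : ℝ) ^ (n + 1) * (P * Real.exp (C * (U + L * ρ))) ≤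
      Real.exp ((e + 2 * (n + 1) + 3 * C) * (U + L * ρ)) := by
    intro ρ
    calc (L : ℝ) ^ (n + 1) * (P * Real.exp (C * (U + L * ρ)))
        ≤ Real.exp ((n + 1) * U) * (P * Real.exp (C * (U + L * ρ))) := by gcongr
      _ = Real.exp ((e + 2 * (n + 1) + 3 * C) * U + C * (L * ρ)) := by
          rw [hP, ← Real.exp_add, ← Real.exp_add]
          ring_nf
      _ ≤ _ := by
          rw [mul_add (e + 2 * (n + 1) + 3 * C)]
          gcongr
          have : (0 : ℝ) ≤ n := Nat.cast_nonneg n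
          linarith
  refine ⟨ξ, hξ0, fun l hl m hm ↦ ?_, fun m hm ρ l hρ hl ↦ ?_, fun m hm ρ z hρ hz ↦ ?_⟩
  · have := hξ (⟨l, hl⟩, fun i ↦ ⟨m i, hm i⟩)
    rw [← this]
    exact sum_congr rfl fun x _ ↦ mul_comm _ _
  · refine house_le_of_forall_norm_le fun φ ↦ ?_
    rw [map_sum, map_sum]
    refine (norm_sum_le _ _).trans (le_trans ?_ (htotal ρ))
    have hcard' : (L : ℝ) ^ (n + 1) = (#(univ : Finset (Fin L × (ι → Fin L))) : ℝ) := by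
      rw [card_univ, hcardβ]
      push_cast
      rfl
    rw [hcard', ← nsmul_eq_mul]
    refine sum_le_card_nsmul _ _ _ fun x _ ↦ ?_
    rw [map_mul, map_mul, norm_mul]
    exact mul_le_mul (hξP φ x) (hcoeff m hm ρ l hρ hl φ x) (norm_nonneg _) (Real.exp_nonneg _)
  · refine le_trans ?_ (htotal ρ)
    exact norm_auxFun_le hc hℓc (hb σ) (hβ σ) hk hLk hm (hξP σ) hρ hz

/-- The inhomogeneous form of Baker's theorem, for algebraic integers. -/
theorem false_of_sum_mul_log_eq (a b : ι → 𝓞 K) (β : 𝓞 K) (hβ0 : β ≠ 0) (σ : K →+* ℂ)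
    (ℓ : ι → ℂ) (hℓ : LinearIndependent ℚ ℓ)
    (hℓa : ∀ i, Complex.exp (ℓ i) = σ (algebraMap (𝓞 K) K (a i)))
    (hsum : ∑ i, σ (algebraMap (𝓞 K) K (b i)) * ℓ i = σ (algebraMap (𝓞 K) K β)) : False := by
  classical
  obtain ⟨D, hD, hsol⟩ := exists_aux_solution a b β σ ℓ
  set n := Fintype.card ι with hn
  set d := Module.finrank ℚ K with hd
  set J : ℕ := (2 * n + 2) * (n + 1) with hJ
  have hlog2 : 0 < Real.log 2 := Real.log_pos one_lt_two
  obtain ⟨T, hT1, hT2, hT3, hT4⟩ :=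
    ((eventually_add_mul_log_lt (D * (d + 1) * (2 ^ J * (J * Real.log 2) + 5))
      (D * (d + 1) * (2 ^ J * (2 * n + 4 : ℕ)))).and
    ((eventually_add_mul_log_lt (10 * ∑ i, ‖ℓ i‖ + 5) 0).and
    ((Filter.eventually_ge_atTop (2 ^ (J * n + 1))).and (Filter.eventually_ge_atTop 3)))).exists
  have hT0 : 0 < T := by omega
  set t : ℝ := (T : ℝ) with ht
  have ht1 : 1 ≤ t := by
    rw [ht]
    exact_mod_cast hT0
  set k : ℕ := 2 ^ J * T ^ (2 * n + 4) with hk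
  set L : ℕ := T ^ (2 * n + 2) with hL
  have hk3 : 3 ≤ k := by
    calc 3 ≤ T := hT4
      _ ≤ T ^ (2 * n + 4) := Nat.le_self_pow (by omega) T
      _ ≤ k := Nat.le_mul_of_pos_left _ (by positivity)
  have hLT : L * T ≤ k := by
    calc L * T = T ^ (2 * n + 3) := by rw [hL]; ring
      _ ≤ T ^ (2 * n + 4) := Nat.pow_le_pow_right hT0 (by omega)
      _ ≤ k := Nat.le_mul_of_pos_left _ (by positivity)
  have hcard : 2 * (T * k ^ n) ≤ L ^ (n + 1) := by
    calc 2 * (T * k ^ n) = 2 ^ (J * n + 1) * T ^ ((2 * n + 4) * n + 1) := by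
          rw [hk, mul_pow, ← pow_mul, ← pow_mul]
          ring
      _ ≤ T * T ^ ((2 * n + 4) * n + 1) := by gcongr
      _ = L ^ (n + 1) := by rw [hL, ← pow_mul, ← pow_succ']; ring_nf
  have hlogk : Real.log k = J * Real.log 2 + (2 * n + 4 : ℕ) * Real.log t := by
    rw [hk]
    push_cast
    rw [Real.log_mul (by positivity) (by positivity), Real.log_pow, Real.log_pow]
    push_cast
    rfl
  obtain ⟨ξ, hξ0, hξ, hF, hA⟩ := hsol T k L hT0 hk3 (Nat.one_le_pow _ _ hT0) hLT hcard
  set p : Fin L × (ι → Fin L) → ℂ := fun x ↦ σ (algebraMap (𝓞 K) K (ξ x)) with hp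
  set F : (ι → ℕ) → ℕ → 𝓞 K := fun m l ↦ ∑ x, ξ x * auxCoeff a b β m l x with hFdef
  have hσ : ∀ m l, σ (algebraMap (𝓞 K) K (F m l)) =
      auxFun ℓ (fun i ↦ σ (algebraMap (𝓞 K) K (b i))) (σ (algebraMap (𝓞 K) K β)) p m l := by
    intro m l
    rw [← sum_mul_auxCoeff hℓa, hFdef]
    simp only [map_sum, map_mul]
    refine sum_congr rfl fun x _ ↦ ?_
    congr 1
    exact map_auxCoeff (σ.comp (algebraMap (𝓞 K) K)) a b β m l x
  have hinj : Function.Injective fun x : 𝓞 K ↦ σ (algebraMap (𝓞 K) K x) :=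
    σ.injective.comp (FaithfulSMul.algebraMap_injective (𝓞 K) K)
  have hind : ∀ j ≤ J, ∀ l < T ^ (j + 1), ∀ m : ι → ℕ,
      (∀ i, m i < 2 ^ (J - j) * T ^ (2 * n + 4)) → F m l = 0 := by
    intro j
    induction j with
    | zero =>
      intro _ l hl m hm
      exact hξ l (by simpa using hl) m hm
    | succ j ih =>
      intro hj
      have hM : 2 ^ (J - j) * T ^ (2 * n + 4) = 2 * (2 ^ (J - (j + 1)) * T ^ (2 * n + 4)) := by
        rw [show J - j = J - (j + 1) + 1 by omega]
        ring
      have ih' := ih (by omega)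
      rw [hM] at ih'
      refine auxSum_eq_zero_of_lt hsum (E := fun ρ ↦ D * (k * Real.log k + L * ρ)) ?_ hσ hF hA
        (R := T ^ (j + 1)) (k := k) ?_ (Nat.pow_le_pow_right hT0 (by omega)) ?_ ih'
      · intro ρ
        have := Real.log_natCast_nonneg k
        positivity
      · rw [← hM, hk]
        gcongr
        · norm_num
        · omega
      · have hR : t ≤ t ^ (j + 1) := le_self_pow₀ ht1 (by omega)
        set R : ℝ := t ^ (j + 1) with hRdef
        set y : ℝ := t ^ (2 * n + 2) with hy
        have hlk := Real.log_natCast_nonneg k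
        have hy0 : 0 < y := by positivity
        have hkr : (k : ℝ) = 2 ^ J * (y * t * t) := by
          rw [hk]
          push_cast
          rw [hy, ← ht]
          ring
        have hLr : (L : ℝ) = y := by rw [hL]; push_cast; rfl
        have hpow : (1 : ℝ) ≤ 2 ^ (J - (j + 1)) := one_le_pow₀ one_le_two
        have hmain : D * (d + 1) * (2 ^ J * Real.log k + 5) < t * Real.log 2 := by
          rw [hlogk]
          refine lt_of_eq_of_lt ?_ hT1
          ring
        push_cast
        rw [← ht, hLr, show t ^ (j + 1 + 1) = t * R by rw [hRdef]; ring, ← hRdef, ← hd]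
        calc D * (k * Real.log k + y * (5 * (t * R))) + d * (D * (k * Real.log k + y * (t * R)))
            ≤ D * (k * Real.log k + y * (5 * (t * R))) +
              d * (D * (k * Real.log k + y * (5 * (t * R)))) := by
              have : 0 ≤ t * R := by positivity
              have : t * R ≤ 5 * (t * R) := by linarith
              gcongr
          _ = D * (d + 1) * (2 ^ J * (y * t * t) * Real.log k + 5 * (y * t * R)) := by
              rw [hkr]; ring
          _ ≤ D * (d + 1) * (2 ^ J * (y * t * R) * Real.log k + 5 * (y * t * R)) := by gcongr
          _ = (y * t * R) * (D * (d + 1) * (2 ^ J * Real.log k + 5)) := by ring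
          _ < (y * t * R) * (t * Real.log 2) := by gcongr
          _ = 1 * t ^ (2 * n + 4) * R * Real.log 2 := by rw [hy]; ring
          _ ≤ _ := by gcongr
  have hfin := mul_log_two_le_of_auxFun (p := p) hℓ hsum
    (fun h ↦ hβ0 (hinj (by simpa using h)))
    (fun h ↦ hξ0 (funext fun x ↦ hinj (by simpa [hp] using congrFun h x)))
    (M := T ^ (2 * n + 4)) (R := T ^ (J + 1)) (Nat.one_le_pow _ _ hT0)
    (fun l hl m hm ↦ by
      rw [← hσ, hind J le_rfl l hl m (by simpa using hm)]
      simp)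
  have hLJ : (L : ℝ) ^ (n + 1) = t ^ J := by
    rw [hL]
    push_cast
    rw [← pow_mul]
  rw [← hn, hLJ, hL] at hfin
  push_cast at hfin
  rw [← ht] at hfin
  set S : ℝ := ∑ i, ‖ℓ i‖ with hS
  have hS0 : 0 ≤ S := sum_nonneg fun _ _ ↦ norm_nonneg _
  set y : ℝ := t ^ (2 * n + 2) with hy
  have hy1 : 1 ≤ y := one_le_pow₀ ht1
  set V : ℝ := t ^ J with hV
  have hV0 : 0 < V := by positivity
  have h1 : t ^ (2 * n + 4) * t ^ (J + 1) = y * V * t * t * t := by rw [hy, hV]; ring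
  have h2 : t ^ (J + 1) = V * t := by rw [hV]; ring
  rw [h1, h2] at hfin
  have h3 : V ≤ y * V * t * t := by
    have : 1 ≤ y * t * t := by
      have := one_le_mul_of_one_le_of_one_le hy1 ht1
      exact one_le_mul_of_one_le_of_one_le this ht1
    nlinarith
  have h4 : y * V * t * S ≤ y * V * t * t * S := by
    have : 0 ≤ y * V * t * S := by positivity
    nlinarith
  have h5 : (y * V * t * t) * (10 * S + 5 + 0 * Real.log t) < (y * V * t * t) * (t * Real.log 2) := by
    gcongr
  nlinarith

end Core

/-- Baker's theorem for linearly independent logarithms of algebraic integers. -/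
theorem sum_mul_log_eq_zero_of_linearIndependent {ι : Type} [Fintype ι] (ℓ β : ι → ℂ)
    (hℓ : LinearIndependent ℚ ℓ)
    (hintegral : ∀ i, IsIntegral ℤ (Complex.exp (ℓ i))) (hβ : ∀ i, IsAlgebraic ℚ (β i))
    (hsum : IsAlgebraic ℚ (∑ i, β i * ℓ i)) : ∑ i, β i * ℓ i = 0 := by
  classical
  by_contra hne
  set Λ := ∑ i, β i * ℓ i with hΛ
  set S : Set ℂ := Set.range (fun i ↦ Complex.exp (ℓ i)) ∪ Set.range β ∪ {Λ} with hS
  set K := IntermediateField.adjoin ℚ S with hK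
  have hfin : S.Finite := ((Set.finite_range _).union (Set.finite_range _)).union
    (Set.finite_singleton _)
  have hSint : ∀ x ∈ S, IsIntegral ℚ x := by
    rintro x ((⟨i, rfl⟩ | ⟨i, rfl⟩) | rfl)
    · exact (hintegral i).tower_top
    · exact (hβ i).isIntegral
    · exact hsum.isIntegral
  have : Finite S := hfin
  have : FiniteDimensional ℚ K := IntermediateField.finiteDimensional_adjoin hSint
  have : NumberField K := { }
  have hsub : S ⊆ K := IntermediateField.subset_adjoin ℚ S
  set α : ι → K := fun i ↦ ⟨Complex.exp (ℓ i), hsub (Or.inl (Or.inl ⟨i, rfl⟩))⟩ with hα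
  set β' : ι → K := fun i ↦ ⟨β i, hsub (Or.inl (Or.inr ⟨i, rfl⟩))⟩ with hβ'
  set Λ' : K := ⟨Λ, hsub (Or.inr rfl)⟩ with hΛ'
  have hαint : ∀ i, IsIntegral ℤ (α i) := fun i ↦
    (isIntegral_algebraMap_iff (FaithfulSMul.algebraMap_injective K ℂ)).1 (hintegral i)
  obtain ⟨y, hy0, hy⟩ := exists_integral_multiples ℤ ℚ (univ.image β' ∪ {Λ'})
  refine false_of_sum_mul_log_eq (K := K) (fun i ↦ ⟨α i, hαint i⟩)
    (fun i ↦ ⟨y • β' i, hy _ (by simp)⟩) ⟨y • Λ', hy _ (by simp)⟩ ?_ (algebraMap K ℂ) ℓ hℓ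
    (fun i ↦ rfl) ?_
  · intro h
    have h1 : y • Λ' = 0 := congrArg Subtype.val h
    rcases smul_eq_zero.1 h1 with h2 | h2
    · exact hy0 h2
    · exact hne (congrArg Subtype.val h2)
  · have h1 : ∀ x : K, algebraMap K ℂ (y • x) = (y : ℂ) * (x : ℂ) := by
      intro x
      rw [zsmul_eq_mul, map_mul, map_intCast]
      rfl
    change ∑ i, algebraMap K ℂ (y • β' i) * ℓ i = algebraMap K ℂ (y • Λ')
    simp only [h1, hβ', hΛ', hΛ, mul_sum, mul_assoc]

/-- Baker's theorem: an algebraic linear combination, with algebraic coefficients, of logarithms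
of algebraic integers vanishes. -/
theorem sum_mul_log_eq_zero_of_isAlgebraic {ι : Type} [Fintype ι] (ℓ β : ι → ℂ)
    (hintegral : ∀ i, IsIntegral ℤ (Complex.exp (ℓ i))) (hβ : ∀ i, IsAlgebraic ℚ (β i))
    (hsum : IsAlgebraic ℚ (∑ i, β i * ℓ i)) : ∑ i, β i * ℓ i = 0 := by
  classical
  obtain ⟨κ, f, hf, hspan, hlin⟩ := exists_linearIndependent' ℚ ℓ
  have : Fintype κ := Fintype.ofInjective f hf
  have hmem : ∀ i, ∃ c : κ → ℚ, ∑ j, c j • ℓ (f j) = ℓ i := fun i ↦ by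
    have : ℓ i ∈ Submodule.span ℚ (Set.range (ℓ ∘ f)) :=
      hspan ▸ Submodule.subset_span (Set.mem_range_self i)
    exact (Submodule.mem_span_range_iff_exists_fun ℚ).1 this
  choose c hc using hmem
  have heq : ∑ i, β i * ℓ i = ∑ j, (∑ i, β i * (c i j : ℂ)) * ℓ (f j) := by
    simp_rw [sum_mul]
    rw [sum_comm]
    refine sum_congr rfl fun i _ ↦ ?_
    rw [← hc i, mul_sum]
    refine sum_congr rfl fun j _ ↦ ?_
    rw [Rat.smul_def, mul_assoc]
  rw [heq] at hsum ⊢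
  refine sum_mul_log_eq_zero_of_linearIndependent (ℓ ∘ f) _ hlin (fun j ↦ hintegral (f j))
    (fun j ↦ ?_) hsum
  have h : ∀ i ∈ univ, IsIntegral ℚ (β i * (c i j : ℂ)) := fun i _ ↦
    ((hβ i).mul (isAlgebraic_algebraMap (c i j))).isIntegral
  exact (IsIntegral.sum _ h).isAlgebraic

/-- The Taylor series of `-log (1 - w)` converges on the unit circle minus the point `1`. -/
lemma tendsto_sum_pow_div_neg_log {w : ℂ} (hw : ‖w‖ = 1) (hw1 : w ≠ 1) :
    Tendsto (fun M ↦ ∑ i ∈ range M, w ^ (i + 1) / ((i : ℂ) + 1)) atTop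
      (𝓝 (-Complex.log (1 - w))) := by
  have hbound : ∀ M, ‖∑ i ∈ range M, w ^ (i + 1)‖ ≤ 2 / ‖w - 1‖ := by
    intro M
    simp_rw [pow_succ']
    rw [← mul_sum, geom_sum_eq hw1, norm_mul, hw, one_mul, norm_div]
    gcongr
    refine (norm_sub_le _ _).trans ?_
    rw [norm_pow, hw]
    norm_num
  have hanti : Antitone fun i : ℕ ↦ 1 / ((i : ℝ) + 1) := fun i j hij ↦ by
    dsimp only
    gcongr
  obtain ⟨l, hl⟩ := cauchySeq_tendsto_of_complete
    (hanti.cauchySeq_series_mul_of_tendsto_zero_of_bounded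
      tendsto_one_div_add_atTop_nhds_zero_nat hbound)
  have hl' : Tendsto (fun M ↦ ∑ i ∈ range M, w ^ (i + 1) / ((i : ℂ) + 1)) atTop (𝓝 l) := by
    refine hl.congr fun M ↦ sum_congr rfl fun i _ ↦ ?_
    rw [Complex.real_smul]
    push_cast
    ring
  have hre : w.re < 1 := by
    refine lt_of_le_of_ne (hw ▸ Complex.re_le_norm w) fun h ↦ hw1 ?_
    have h1 : w.re ^ 2 + w.im ^ 2 = 1 := by
      have := Complex.sq_norm w
      rw [hw, Complex.normSq_apply] at this
      linarith
    have h2 : w.im = 0 := by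
      rw [h] at h1
      have : w.im ^ 2 = 0 := by linarith
      simpa using this
    exact Complex.ext (by simpa using h) (by simpa using h2)
  have habel := Complex.tendsto_tsum_powerSeries_nhdsWithin_lt hl'
  rw [tendsto_map'_iff] at habel
  have hlog : Tendsto (fun x : ℝ ↦ -Complex.log (1 - w * x) / x) (𝓝[<] 1)
      (𝓝 (-Complex.log (1 - w))) := by
    have hc : ContinuousAt (fun x : ℝ ↦ -Complex.log (1 - w * x) / x) 1 := by
      refine ContinuousAt.div ?_ Complex.continuous_ofReal.continuousAt (by simp)
      refine (ContinuousAt.clog ?_ ?_).neg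
      · fun_prop
      · left
        simpa using hre
    have := hc.tendsto.mono_left (nhdsWithin_le_nhds (s := Set.Iio 1))
    simpa using this
  have heq : l = -Complex.log (1 - w) := by
    refine tendsto_nhds_unique habel (hlog.congr' ?_)
    have hmem : Set.Ioo (0 : ℝ) 1 ∈ 𝓝[<] (1 : ℝ) := Ioo_mem_nhdsLT one_pos
    filter_upwards [hmem] with x hx
    have hwx : ‖w * x‖ < 1 := by
      rw [norm_mul, hw, one_mul, Complex.norm_real, Real.norm_of_nonneg hx.1.le]
      exact hx.2
    have hx0 : (x : ℂ) ≠ 0 := by exact_mod_cast hx.1.ne'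
    have h1 := (Complex.hasSum_taylorSeries_neg_log' hwx).div_const (x : ℂ)
    rw [← h1.tsum_eq]
    refine tsum_congr fun i ↦ ?_
    field_simp
    ring
  rwa [heq] at hl'

lemma IsPrimitiveRoot.sum_pow_pow_eq_ite {ζ : ℂ} {n : ℕ} (hζ : IsPrimitiveRoot ζ n) (N : ℕ) :
    ∑ k ∈ range n, (ζ ^ k) ^ N = if n ∣ N then (n : ℂ) else 0 := by
  simp_rw [← pow_mul, mul_comm _ N, pow_mul]
  split_ifs with h
  · simp [(hζ.pow_eq_one_iff_dvd N).2 h]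
  · rw [geom_sum_eq (fun h1 ↦ h ((hζ.pow_eq_one_iff_dvd N).1 h1)), ← pow_mul, mul_comm, pow_mul,
      hζ.pow_eq_one]
    simp

lemma summable_one_div_sub_one_div {x : ℝ} (hx : 0 < x) :
    Summable fun k : ℕ ↦ 1 / ((k : ℝ) + 1) - 1 / (((k : ℝ) + 1) + x) := by
  have h : Summable fun k : ℕ ↦ x * (1 / ((k + 1 : ℕ) : ℝ) ^ 2) :=
    ((summable_nat_add_iff 1).2 (Real.summable_one_div_nat_pow.2 one_lt_two)).mul_left x
  refine Summable.of_nonneg_of_le (fun k ↦ ?_) (fun k ↦ ?_) h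
  · exact sub_nonneg.2 (one_div_le_one_div_of_le (by positivity) (by linarith))
  · have hk : (0 : ℝ) < (k : ℝ) + 1 := by positivity
    rw [div_sub_div _ _ hk.ne' (by positivity), ← mul_div_assoc]
    push_cast
    gcongr
    · linarith
    · nlinarith

lemma tendsto_sum_digamma {x : ℝ} (hx : 0 < x) :
    Tendsto (fun M ↦ ∑ q ∈ range M, (1 / ((q : ℝ) + 1) - 1 / ((q : ℝ) + x))) atTop
      (𝓝 (digamma x + Real.eulerMascheroniConstant)) := by
  have h1 := (summable_one_div_sub_one_div hx).hasSum.tendsto_sum_nat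
  have h2 : Tendsto (fun M : ℕ ↦ 1 / ((M : ℝ) + x)) atTop (𝓝 0) :=
    (tendsto_atTop_add_const_right _ x tendsto_natCast_atTop_atTop).const_div_atTop 1
  have h3 := (h1.add h2).sub (tendsto_const_nhds (x := 1 / x))
  have h4 : ∀ M : ℕ, ∑ q ∈ range M, (1 / ((q : ℝ) + 1) - 1 / ((q : ℝ) + x)) =
      ∑ q ∈ range M, (1 / ((q : ℝ) + 1) - 1 / (((q : ℝ) + 1) + x)) + 1 / ((M : ℝ) + x) - 1 / x := by
    intro M
    induction M with
    | zero => simp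
    | succ M ih =>
      rw [sum_range_succ, sum_range_succ, ih]
      push_cast
      ring
  simp_rw [← h4] at h3
  convert! h3 using 2
  rw [digamma]
  ring

lemma digamma_add_eulerMascheroniConstant_neg {x : ℝ} (hx : 0 < x) (hx1 : x < 1) :
    digamma x + Real.eulerMascheroniConstant < 0 := by
  have h1 : ∑' k : ℕ, (1 / ((k : ℝ) + 1) - 1 / (((k : ℝ) + 1) + x)) ≤ 1 := by
    refine Real.tsum_le_of_sum_range_le (fun k ↦ ?_) fun M ↦ ?_
    · exact sub_nonneg.2 (one_div_le_one_div_of_le (by positivity) (by linarith))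
    · calc ∑ k ∈ range M, (1 / ((k : ℝ) + 1) - 1 / (((k : ℝ) + 1) + x))
          ≤ ∑ k ∈ range M, (1 / ((k : ℝ) + 1) - 1 / (((k + 1 : ℕ) : ℝ) + 1)) := by
            gcongr with k hk
            push_cast
            linarith
        _ = 1 - 1 / ((M : ℝ) + 1) := by
            rw [sum_range_sub' (fun k : ℕ ↦ 1 / ((k : ℝ) + 1))]
            simp
        _ ≤ 1 := by
            have : (0 : ℝ) ≤ 1 / ((M : ℝ) + 1) := by positivity
            linarith
  have h2 : 1 < 1 / x := by rwa [lt_div_iff₀ hx, one_mul]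
  rw [digamma]
  linarith

/-- Gauss's formula for the digamma function at rational arguments. -/
lemma digamma_add_eulerMascheroniConstant_eq {n r : ℕ} (hr : 1 ≤ r) (hrn : r < n) {ζ : ℂ}
    (hζ : IsPrimitiveRoot ζ n) :
    ((digamma ((r : ℝ) / n) + Real.eulerMascheroniConstant : ℝ) : ℂ) =
      ∑ k ∈ range n, ((ζ ^ k) ^ (n - r) - 1) * Complex.log (1 - ζ ^ k) := by
  have hn : 0 < n := by omega
  have hn' : (n : ℂ) ≠ 0 := by exact_mod_cast hn.ne'
  set S : ℕ → ℕ → ℂ := fun k M ↦ ∑ i ∈ range M, (ζ ^ k) ^ (i + 1) / ((i : ℂ) + 1) with hS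
  have h1 : Tendsto (fun M ↦ ∑ k ∈ range n, (1 - (ζ ^ k) ^ (n - r)) * S k (n * M)) atTop
      (𝓝 (∑ k ∈ range n, (1 - (ζ ^ k) ^ (n - r)) * (-Complex.log (1 - ζ ^ k)))) := by
    refine tendsto_finsetSum _ fun k hk ↦ ?_
    by_cases hk1 : ζ ^ k = 1
    · simp [hk1]
    · refine Tendsto.const_mul _ ?_
      have hnorm : ‖ζ ^ k‖ = 1 := by rw [norm_pow, hζ.norm'_eq_one hn.ne', one_pow]
      exact (tendsto_sum_pow_div_neg_log hnorm hk1).comp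
        (tendsto_id.const_mul_atTop' hn)
  have h2 : ∀ M, ∑ k ∈ range n, (1 - (ζ ^ k) ^ (n - r)) * S k M =
      ∑ i ∈ range M, ((if n ∣ i + 1 then (n : ℂ) else 0) -
        (if n ∣ i + 1 + (n - r) then (n : ℂ) else 0)) / ((i : ℂ) + 1) := by
    intro M
    simp only [hS, mul_sum]
    rw [sum_comm]
    refine sum_congr rfl fun i _ ↦ ?_
    rw [← hζ.sum_pow_pow_eq_ite, ← hζ.sum_pow_pow_eq_ite, ← sum_sub_distrib, sum_div]
    refine sum_congr rfl fun k _ ↦ ?_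
    ring
  have h3 : ∀ M, ∑ i ∈ range (n * M), ((if n ∣ i + 1 then (n : ℂ) else 0) -
        (if n ∣ i + 1 + (n - r) then (n : ℂ) else 0)) / ((i : ℂ) + 1) =
      ((∑ q ∈ range M, (1 / ((q : ℝ) + 1) - 1 / ((q : ℝ) + (r : ℝ) / n)) : ℝ) : ℂ) := by
    intro M
    induction M with
    | zero => simp
    | succ M ih =>
      rw [mul_add_one, sum_range_add, ih, sum_range_succ]
      push_cast
      congr 1
      simp only [sub_div]
      rw [sum_sub_distrib]
      congr 1
      · rw [sum_eq_single (n - 1)]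
        · have : n ∣ n * M + (n - 1) + 1 := ⟨M + 1, by rw [mul_add]; omega⟩
          rw [if_pos this]
          have h : ((n - 1 : ℕ) : ℂ) = (n : ℂ) - 1 := by
            rw [Nat.cast_sub (by omega)]; simp
          rw [h]
          have : (M : ℂ) + 1 ≠ 0 := by exact_mod_cast M.succ_ne_zero
          rw [show (n : ℂ) * M + (n - 1) + 1 = n * (M + 1) by ring]
          field_simp
        · intro j hj hjn
          have hj := mem_range.1 hj
          rw [if_neg, zero_div]
          rw [add_assoc, Nat.dvd_add_right (dvd_mul_right n M)]
          exact Nat.not_dvd_of_pos_of_lt (by omega) (by omega)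
        · intro h
          exact absurd (mem_range.2 (by omega)) h
      · rw [sum_eq_single (r - 1)]
        · have : n ∣ n * M + (r - 1) + 1 + (n - r) := ⟨M + 1, by rw [mul_add]; omega⟩
          rw [if_pos this]
          have h : ((r - 1 : ℕ) : ℂ) = (r : ℂ) - 1 := by
            rw [Nat.cast_sub (by omega)]; simp
          rw [h]
          have h0 : (n : ℂ) * M + r ≠ 0 := by
            exact_mod_cast (by positivity : n * M + r ≠ 0)
          rw [show (n : ℂ) * M + (r - 1) + 1 = n * M + r by ring]
          have h0' : (M : ℂ) + r / n ≠ 0 := by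
            intro h
            apply h0
            field_simp at h
            linear_combination h
          field_simp
        · intro j hj hjn
          have hj := mem_range.1 hj
          rw [if_neg, zero_div]
          rw [add_assoc, add_assoc, Nat.dvd_add_right (dvd_mul_right n M)]
          rintro ⟨d, hd⟩
          have hd0 : d = 1 := by
            have h1 : d < 2 := by
              by_contra! h
              have := Nat.mul_le_mul_left n h
              omega
            have h2 : d ≠ 0 := by rintro rfl; omega
            omega
          subst hd0
          omega
        · intro h
          exact absurd (mem_range.2 (by omega)) h
  have hx : 0 < (r : ℝ) / n := by
    have : (0 : ℝ) < r := by exact_mod_cast hr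
    positivity
  have h4 := (Complex.continuous_ofReal.tendsto _).comp (tendsto_sum_digamma hx)
  simp_rw [h2, h3] at h1
  rw [tendsto_nhds_unique h4 h1]
  refine sum_congr rfl fun k _ ↦ ?_
  ring

/-- The coefficients and the logarithms in Gauss's formula satisfy the assumptions of Baker's
theorem. -/
lemma exists_digamma_eq_sum_mul_log {n r : ℕ} (hr : 1 ≤ r) (hrn : r < n) :
    ∃ ℓ β : Fin n → ℂ, (∀ i, IsIntegral ℤ (Complex.exp (ℓ i))) ∧ (∀ i, IsAlgebraic ℚ (β i)) ∧
      ((digamma ((r : ℝ) / n) + Real.eulerMascheroniConstant : ℝ) : ℂ) = ∑ i, β i * ℓ i := by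
  have hn : n ≠ 0 := by omega
  set ζ := Complex.exp (2 * Real.pi * Complex.I / n)
  have hζ : IsPrimitiveRoot ζ n := Complex.isPrimitiveRoot_exp n hn
  have hintegral : IsIntegral ℤ ζ := hζ.isIntegral (Nat.pos_of_ne_zero hn)
  refine ⟨fun i ↦ Complex.log (1 - ζ ^ (i : ℕ)), fun i ↦ (ζ ^ (i : ℕ)) ^ (n - r) - 1,
    fun i ↦ ?_, fun i ↦ ?_, ?_⟩
  · dsimp only
    by_cases h : 1 - ζ ^ (i : ℕ) = 0
    · simpa [h] using isIntegral_one
    · rw [Complex.exp_log h]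
      exact isIntegral_one.sub (hintegral.pow _)
  · exact ((((hintegral.pow _).pow _).sub isIntegral_one).tower_top (A := ℚ)).isAlgebraic
  · rw [digamma_add_eulerMascheroniConstant_eq hr hrn hζ, sum_range]

lemma not_isAlgebraic_digamma_add_eulerMascheroniConstant {n r : ℕ} (hr : 1 ≤ r) (hrn : r < n) :
    ¬ IsAlgebraic ℚ (digamma ((r : ℝ) / n) + Real.eulerMascheroniConstant) := by
  intro h
  obtain ⟨ℓ, β, hℓ, hβ, heq⟩ := exists_digamma_eq_sum_mul_log hr hrn
  have h1 : IsAlgebraic ℚ (∑ i, β i * ℓ i) := heq ▸ h.algebraMap (A := ℂ)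
  have h2 := sum_mul_log_eq_zero_of_isAlgebraic ℓ β hℓ hβ h1
  rw [← heq, Complex.ofReal_eq_zero] at h2
  have hr' : (0 : ℝ) < r := by exact_mod_cast hr
  have hrn' : (r : ℝ) < n := by exact_mod_cast hrn
  have hn' : (0 : ℝ) < n := hr'.trans hrn'
  exact (digamma_add_eulerMascheroniConstant_neg (div_pos hr' hn')
    ((div_lt_one hn').2 hrn')).ne h2

lemma digamma_eq_of_isAlgebraic_sub {n r n' r' : ℕ} (hr : 1 ≤ r) (hrn : r < n) (hr' : 1 ≤ r')
    (hrn' : r' < n')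
    (h : IsAlgebraic ℚ (digamma ((r : ℝ) / n) - digamma ((r' : ℝ) / n'))) :
    digamma ((r : ℝ) / n) = digamma ((r' : ℝ) / n') := by
  obtain ⟨ℓ, β, hℓ, hβ, heq⟩ := exists_digamma_eq_sum_mul_log hr hrn
  obtain ⟨ℓ', β', hℓ', hβ', heq'⟩ := exists_digamma_eq_sum_mul_log hr' hrn'
  have hsum : ((digamma ((r : ℝ) / n) - digamma ((r' : ℝ) / n') : ℝ) : ℂ) =
      ∑ i, Sum.elim β (-β') i * Sum.elim ℓ ℓ' i := by
    rw [Fintype.sum_sum_type]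
    simp only [Sum.elim_inl, Sum.elim_inr, Pi.neg_apply, neg_mul, sum_neg_distrib]
    rw [← heq, ← heq']
    push_cast
    ring
  have h1 := sum_mul_log_eq_zero_of_isAlgebraic (Sum.elim ℓ ℓ') (Sum.elim β (-β'))
    (Sum.rec hℓ hℓ') (Sum.rec hβ fun i ↦ (hβ' i).neg) (hsum ▸ h.algebraMap (A := ℂ))
  rw [← hsum, Complex.ofReal_eq_zero] at h1
  exact sub_eq_zero.1 h1

/-- At most one member of the infinite collection
`{γ} ∪ {ψ(r/n) : n > 1, 1 ≤ r < n, gcd(r,n) = 1}` is algebraic. -/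
theorem at_most_one_algebraic_digamma_all :
    ¬ ∃ x y : ℝ, x ∈ digammaSetAll ∧ y ∈ digammaSetAll ∧ x ≠ y ∧
      IsAlgebraic ℚ x ∧ IsAlgebraic ℚ y := by
  rintro ⟨x, y, hx, hy, hxy, hxa, hya⟩
  rcases hx with rfl | ⟨n, r, -, hr, hrn, -, rfl⟩ <;>
    rcases hy with rfl | ⟨n', r', -, hr', hrn', -, rfl⟩
  · exact hxy rfl
  · exact not_isAlgebraic_digamma_add_eulerMascheroniConstant hr' hrn' (hya.add hxa)
  · exact not_isAlgebraic_digamma_add_eulerMascheroniConstant hr hrn (hxa.add hya)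
  · exact hxy (digamma_eq_of_isAlgebraic_sub hr hrn hr' hrn' (hxa.sub hya))
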